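/- Let M be a positive integer and let (q_0, q_0^*) ⊂ (q', M+1) \ closure(U) be a connected component. Then the Hausdorff dimension of π_{M+1}(U'_{q_0^*} \ U'_{q_0}) equals 0. -/

import Mathlib

open Set MeasureTheory Filter

noncomputable section

/-- The projection `π_q` of a digit sequence (0-indexed): `∑ d i / q^(i+1)`. -/
def piQ (q : ℝ) (d : ℕ → ℕ) : ℝ := ∑' i : ℕ, (d i : ℝ) / q ^ (i + 1)

/-- `d` is a `q`-expansion of `x` over the alphabet `{0,…,M}`. -/
def IsExpansion (M : ℕ) (q x : ℝ) (d : ℕ → ℕ) : Prop :=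
  (∀ i, d i ≤ M) ∧ piQ q d = x

/-- `U'_q`: digit sequences that are the unique `q`-expansion of their projection. -/
def UnivSeqs (M : ℕ) (q : ℝ) : Set (ℕ → ℕ) :=
  {d | (∀ i, d i ≤ M) ∧ ∀ e : ℕ → ℕ, IsExpansion M q (piQ q d) e → e = d}

/-- The set `U = U(M)` of univoque bases: `q ∈ (1, M+1]` such that `1` has a
unique `q`-expansion over `{0,…,M}`. -/
def UnivBases (M : ℕ) : Set ℝ :=
  {q | 1 < q ∧ q ≤ M + 1 ∧ ∃! d : ℕ → ℕ, IsExpansion M q 1 d}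

/-- The Komornik–Loreti constant `q'(M) = min U(M)`. -/
def KL (M : ℕ) : ℝ := sInf (UnivBases M)

/-- `(a, b)` is a connected component of `(q'(M), M+1) \ closure (U(M))`:
an open subinterval whose endpoints do not lie in that (open) set. -/
def CC (M : ℕ) (a b : ℝ) : Prop :=
  a < b ∧ Ioo a b ⊆ Ioo (KL M) (M + 1) \ closure (UnivBases M) ∧
    a ∉ Ioo (KL M) (M + 1) \ closure (UnivBases M) ∧
    b ∉ Ioo (KL M) (M + 1) \ closure (UnivBases M)

/-- `x ∈ [0, M/(q-1)]` has exactly two distinct `q`-expansions. -/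
def HasExactlyTwoExpansions (M : ℕ) (q x : ℝ) : Prop :=
  ∃ c d : ℕ → ℕ, c ≠ d ∧ IsExpansion M q x c ∧ IsExpansion M q x d ∧
    ∀ e : ℕ → ℕ, IsExpansion M q x e → e = c ∨ e = d

/-- `B_2(M)`: bases `q ∈ (1, M+1]` for which some `x ∈ [0, M/(q-1)]` has exactly
two `q`-expansions. -/
def B2 (M : ℕ) : Set ℝ :=
  {q | 1 < q ∧ q ≤ M + 1 ∧
    ∃ x ∈ Icc (0 : ℝ) (M / (q - 1)), HasExactlyTwoExpansions M q x}

/-- Strict lexicographic order on digit sequences. -/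
def seqLt (a b : ℕ → ℕ) : Prop := ∃ n, (∀ i < n, a i = b i) ∧ a n < b n

/-- Lexicographic order on digit sequences. -/
def seqLe (a b : ℕ → ℕ) : Prop := seqLt a b ∨ a = b

/-- A digit sequence is infinite if it does not end with `0^∞` after a last
nonzero digit (in particular `0^∞` is infinite). -/
def IsInfiniteSeq (a : ℕ → ℕ) : Prop := ¬∃ m, a m ≠ 0 ∧ ∀ i > m, a i = 0

/-- `a = α(q)`, the quasi-greedy `q`-expansion of `1`: the lexicographically
largest infinite `q`-expansion of `1`. -/
def IsQuasiGreedy (M : ℕ) (q : ℝ) (a : ℕ → ℕ) : Prop :=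
  IsExpansion M q 1 a ∧ IsInfiniteSeq a ∧
    ∀ b : ℕ → ℕ, IsExpansion M q 1 b → IsInfiniteSeq b → seqLe b a

/-- `b = β(q)`, the greedy `q`-expansion of `1`: the lexicographically largest
`q`-expansion of `1`. -/
def IsGreedy (M : ℕ) (q : ℝ) (b : ℕ → ℕ) : Prop :=
  IsExpansion M q 1 b ∧ ∀ c : ℕ → ℕ, IsExpansion M q 1 c → seqLe c b

/-- `w⁺`: increase the last digit of a word by one. -/
def plusWord : List ℕ → List ℕ
  | [] => []
  | [a] => [a + 1]
  | a :: b :: rest => a :: plusWord (b :: rest)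

/-- `w⁻`: decrease the last digit of a word by one. -/
def minusWord : List ℕ → List ℕ
  | [] => []
  | [a] => [a - 1]
  | a :: b :: rest => a :: minusWord (b :: rest)

/-- The reflection of a word: `\overline{w} = (M - w_1) ⋯ (M - w_k)`. -/
def reflWord (M : ℕ) (w : List ℕ) : List ℕ := w.map fun a => M - a

/-- The substitution `g(w) = w⁺ \overline{w⁺}`. -/
def gWord (M : ℕ) (w : List ℕ) : List ℕ := plusWord w ++ reflWord M (plusWord w)

/-- The periodic sequence `t^∞` determined by a word `t`. -/
def periodicSeq (t : List ℕ) (i : ℕ) : ℕ := t.getD (i % t.length) 0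

/-- Strict lexicographic order on words. -/
def wordLt (u v : List ℕ) : Prop := List.Lex (· < ·) u v

/-- Lexicographic order on words. -/
def wordLe (u v : List ℕ) : Prop := wordLt u v ∨ u = v

/-- The connected component `(q_0, q_0^*)` of `(q'(M), M+1) \ closure (U(M))` is
generated by the word `t`, and `θ = α(q_0^*)`: `α(q_0) = t^∞` and
`α(q_0^*) = lim_{n→∞} g^n(t)`, i.e. every `g^n(t)` is a prefix of `θ`. -/
def GeneratedBy (M : ℕ) (q₀ q₀star : ℝ) (t : List ℕ) (θ : ℕ → ℕ) : Prop :=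
  CC M q₀ q₀star ∧ t ≠ [] ∧ IsQuasiGreedy M q₀ (periodicSeq t) ∧
    IsQuasiGreedy M q₀star θ ∧
    ∀ n : ℕ, ∀ i < ((gWord M)^[n] t).length, ((gWord M)^[n] t).getD i 0 = θ i

/-- The shifted sequence `a_m a_{m+1} ⋯`. -/
def shiftSeq (m : ℕ) (a : ℕ → ℕ) : ℕ → ℕ := fun i => a (m + i)

/-- The reflection `i ↦ M - a i` of a digit sequence. -/
def reflSeq (M : ℕ) (a : ℕ → ℕ) : ℕ → ℕ := fun i => M - a i

/-- `a` and `b` have the same prefix of length `L`. -/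
def eqUpto (L : ℕ) (a b : ℕ → ℕ) : Prop := ∀ i < L, a i = b i

/-- The prefix of length `L` of `a` is lexicographically smaller than that of `b`. -/
def ltUpto (L : ℕ) (a b : ℕ → ℕ) : Prop := ∃ j < L, (∀ i < j, a i = b i) ∧ a j < b j

theorem shiftSeq_shiftSeq (m k : ℕ) (a : ℕ → ℕ) :
    shiftSeq m (shiftSeq k a) = shiftSeq (k + m) a := by
  funext i; simp [shiftSeq, add_assoc]

theorem shiftSeq_zero (a : ℕ → ℕ) : shiftSeq 0 a = a := by
  funext i; simp [shiftSeq]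

theorem reflSeq_shiftSeq (M m : ℕ) (a : ℕ → ℕ) :
    reflSeq M (shiftSeq m a) = shiftSeq m (reflSeq M a) := rfl

theorem reflSeq_le (M : ℕ) (a : ℕ → ℕ) (i : ℕ) : reflSeq M a i ≤ M := Nat.sub_le _ _

theorem shiftSeq_le {M : ℕ} {a : ℕ → ℕ} (ha : ∀ i, a i ≤ M) (m i : ℕ) : shiftSeq m a i ≤ M :=
  ha _

theorem reflSeq_reflSeq {M : ℕ} {a : ℕ → ℕ} (ha : ∀ i, a i ≤ M) :
    reflSeq M (reflSeq M a) = a := by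
  funext i; have := ha i; simp only [reflSeq]; omega

theorem exists_first_ne {a b : ℕ → ℕ} (h : a ≠ b) : ∃ n, (∀ i < n, a i = b i) ∧ a n ≠ b n := by
  classical
  have h' : ∃ n, a n ≠ b n := Function.ne_iff.1 h
  exact ⟨Nat.find h', fun i hi => not_not.1 (Nat.find_min h' hi), Nat.find_spec h'⟩

theorem ltUpto.seqLt {L : ℕ} {a b : ℕ → ℕ} (h : ltUpto L a b) : seqLt a b := by
  obtain ⟨j, -, h⟩ := h; exact ⟨j, h⟩

theorem ltUpto.mono {L K : ℕ} {a b : ℕ → ℕ} (h : ltUpto L a b) (hL : L ≤ K) : ltUpto K a b := by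
  obtain ⟨j, hj, h⟩ := h; exact ⟨j, by omega, h⟩

theorem seqLt_asymm {a b : ℕ → ℕ} (h : seqLt a b) : ¬ seqLt b a := by
  rintro ⟨m, hm, hm'⟩
  obtain ⟨n, hn, hn'⟩ := h
  rcases lt_trichotomy m n with h | rfl | h
  · have := hn m h; omega
  · omega
  · have := hm n h; omega

theorem seqLt_irrefl (a : ℕ → ℕ) : ¬ seqLt a a := by
  rintro ⟨m, -, hm⟩; omega

theorem eq_or_seqLt_of_not {a b : ℕ → ℕ} (h : ¬ seqLt b a) : a = b ∨ seqLt a b := by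
  by_cases hab : a = b
  · exact Or.inl hab
  · obtain ⟨n, hn, hn'⟩ := exists_first_ne hab
    rcases lt_or_gt_of_ne hn' with h' | h'
    · exact Or.inr ⟨n, hn, h'⟩
    · exact absurd ⟨n, fun i hi => (hn i hi).symm, h'⟩ h

theorem seqLt.trans {a b c : ℕ → ℕ} (h : seqLt a b) (h' : seqLt b c) : seqLt a c := by
  obtain ⟨m, hm, hm'⟩ := h
  obtain ⟨n, hn, hn'⟩ := h'
  rcases lt_trichotomy m n with h | rfl | h
  · exact ⟨m, fun i hi => (hm i hi).trans (hn i (by omega)), by rw [← hn m h]; exact hm'⟩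
  · exact ⟨m, fun i hi => (hm i hi).trans (hn i hi), hm'.trans hn'⟩
  · exact ⟨n, fun i hi => (hm i (by omega)).trans (hn i hi), by rw [hm n h]; exact hn'⟩

theorem seqLt.trans_not {a b c : ℕ → ℕ} (h : seqLt a b) (h' : ¬ seqLt c b) : seqLt a c := by
  rcases eq_or_seqLt_of_not h' with rfl | h'
  · exact h
  · exact h.trans h'

theorem seqLt_of_not_of_lt {a b c : ℕ → ℕ} (h : ¬ seqLt b a) (h' : seqLt b c) : seqLt a c := by
  rcases eq_or_seqLt_of_not h with rfl | h
  · exact h'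
  · exact h.trans h'

theorem ltUpto_or_eqUpto_of_not {a b : ℕ → ℕ} (h : ¬ seqLt b a) (L : ℕ) :
    ltUpto L a b ∨ eqUpto L a b := by
  rcases eq_or_seqLt_of_not h with rfl | ⟨n, hn, hn'⟩
  · exact Or.inr fun _ _ => rfl
  · by_cases hL : n < L
    · exact Or.inl ⟨n, hL, hn, hn'⟩
    · exact Or.inr fun i hi => hn i (by omega)

theorem ltUpto.refl {M L : ℕ} {a b : ℕ → ℕ} (hb : ∀ i, b i ≤ M) (h : ltUpto L a b) :
    ltUpto L (reflSeq M b) (reflSeq M a) := by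
  obtain ⟨j, hj, h, h'⟩ := h
  refine ⟨j, hj, fun i hi => by simp only [reflSeq, h i hi], ?_⟩
  have := hb j
  simp only [reflSeq]; omega

theorem eqUpto.refl {M L : ℕ} {a b : ℕ → ℕ} (h : eqUpto L a b) :
    eqUpto L (reflSeq M b) (reflSeq M a) := fun i hi => by simp only [reflSeq, h i hi]

theorem seqLt.refl {M : ℕ} {a b : ℕ → ℕ} (hb : ∀ i, b i ≤ M) (h : seqLt a b) :
    seqLt (reflSeq M b) (reflSeq M a) := by
  obtain ⟨j, hj⟩ := h
  exact (ltUpto.refl hb ⟨j, j.lt_succ_self, hj⟩).seqLt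

theorem eqUpto.append_ltUpto {m l : ℕ} {a b : ℕ → ℕ} (h : eqUpto m a b)
    (h' : ltUpto l (shiftSeq m a) (shiftSeq m b)) : ltUpto (m + l) a b := by
  obtain ⟨j, hj, h1, h2⟩ := h'
  refine ⟨m + j, by omega, fun i hi => ?_, h2⟩
  by_cases him : i < m
  · exact h i him
  · have := h1 (i - m) (by omega)
    simpa [shiftSeq, show m + (i - m) = i by omega] using this

theorem eqUpto.append {m l : ℕ} {a b : ℕ → ℕ} (h : eqUpto m a b)
    (h' : eqUpto l (shiftSeq m a) (shiftSeq m b)) : eqUpto (m + l) a b := by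
  intro i hi
  by_cases him : i < m
  · exact h i him
  · have := h' (i - m) (by omega)
    simpa [shiftSeq, show m + (i - m) = i by omega] using this

/-- Increasing the last letter of a strictly smaller word keeps it weakly smaller. -/
theorem ltUpto.incr_last {L : ℕ} {a a' b : ℕ → ℕ} (h : ltUpto (L + 1) a b)
    (ha : ∀ i < L, a' i = a i) (haL : a' L = a L + 1) :
    ltUpto (L + 1) a' b ∨ eqUpto (L + 1) a' b := by
  obtain ⟨j, hj, h1, h2⟩ := h
  by_cases hjL : j < L
  · exact Or.inl ⟨j, hj, fun i hi => by rw [ha i (by omega), h1 i hi], by rw [ha j hjL]; exact h2⟩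
  · obtain rfl : j = L := by omega
    rcases Nat.lt_or_ge (a' j) (b j) with h | h
    · exact Or.inl ⟨j, hj, fun i hi => by rw [ha i (by omega), h1 i hi], h⟩
    · refine Or.inr fun i hi => ?_
      by_cases hij : i < j
      · rw [ha i hij, h1 i hij]
      · obtain rfl : i = j := by omega
        omega

/-- Increasing the last letter of a weakly larger word makes it strictly larger. -/
theorem ltUpto_of_incr_last {L : ℕ} {a a' b b' : ℕ → ℕ}
    (h : ltUpto (L + 1) a b ∨ eqUpto (L + 1) a b)
    (ha : ∀ i < L, a' i = a i) (haL : a' L ≤ a L) (hb : ∀ i < L, b' i = b i) (hbL : b L < b' L) :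
    ltUpto (L + 1) a' b' := by
  rcases h with ⟨j, hj, h1, h2⟩ | h
  · refine ⟨j, hj, fun i hi => by rw [ha i (by omega), hb i (by omega), h1 i hi], ?_⟩
    by_cases hjL : j < L
    · rw [ha j hjL, hb j hjL]; exact h2
    · obtain rfl : j = L := by omega
      omega
  · refine ⟨L, L.lt_succ_self, fun i hi => by rw [ha i hi, hb i hi, h i (by omega)], ?_⟩
    have := h L L.lt_succ_self
    omega

/-- If all tails of `e` following a digit below `M` are smaller than `a`, and so is `e` itself,
then all tails of `e` are. -/
theorem seqLt_shiftSeq_of_forall {M : ℕ} {a e : ℕ → ℕ} (haM : ∀ i, a i ≤ M)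
    (ha : ¬ seqLt a (shiftSeq 1 a)) (h0 : seqLt e a)
    (heM : ∀ i, e i ≤ M) (he : ∀ n, e n < M → seqLt (shiftSeq (n + 1) e) a) (m : ℕ) :
    seqLt (shiftSeq m e) a := by
  induction m with
  | zero => rwa [shiftSeq_zero]
  | succ m ih =>
    rcases (heM m).lt_or_eq with h | h
    · exact he m h
    · obtain ⟨j, hj1, hj2⟩ := ih
      have hs0 : shiftSeq m e 0 = M := by simpa [shiftSeq] using h
      cases j with
      | zero => have := haM 0; omega
      | succ j =>
        refine seqLt.trans_not (b := shiftSeq 1 a) ⟨j, fun i hi => ?_, ?_⟩ ha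
        · have := hj1 (i + 1) (by omega)
          simpa [shiftSeq, add_comm, add_left_comm] using this
        · simpa [shiftSeq, add_comm, add_left_comm] using hj2

theorem piQ_summable {M : ℕ} {q : ℝ} (hq : 1 < q) {d : ℕ → ℕ} (hd : ∀ i, d i ≤ M) :
    Summable fun i : ℕ => (d i : ℝ) / q ^ (i + 1) := by
  have hq0 : 0 < q := by linarith
  have hs : Summable fun i : ℕ => (M : ℝ) * (q⁻¹) ^ i :=
    (summable_geometric_of_lt_one (by positivity) (inv_lt_one_of_one_lt₀ hq)).mul_left _
  refine Summable.of_nonneg_of_le (fun i => by positivity) (fun i => ?_) hs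
  rw [inv_pow, ← div_eq_mul_inv]
  have : (d i : ℝ) ≤ M := by exact_mod_cast hd i
  gcongr
  · exact hq.le
  · omega

theorem piQ_nonneg {q : ℝ} (hq : 1 < q) (d : ℕ → ℕ) : 0 ≤ piQ q d :=
  tsum_nonneg fun i => by have : 0 < q := by linarith
                          positivity

theorem piQ_split {M : ℕ} {q : ℝ} (hq : 1 < q) {d : ℕ → ℕ} (hd : ∀ i, d i ≤ M) (n : ℕ) :
    piQ q d = ∑ i ∈ Finset.range n, (d i : ℝ) / q ^ (i + 1) + piQ q (shiftSeq n d) / q ^ n := by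
  have hq0 : q ≠ 0 := by linarith
  rw [piQ, ← (piQ_summable hq hd).sum_add_tsum_nat_add n, piQ, ← tsum_div_const]
  congr 1
  refine tsum_congr fun i => ?_
  simp only [shiftSeq]
  rw [div_div, ← pow_add, add_comm i n, show n + i + 1 = i + 1 + n by ring]

theorem piQ_sub_of_agree {M : ℕ} {q : ℝ} (hq : 1 < q) {a b : ℕ → ℕ} (ha : ∀ i, a i ≤ M)
    (hb : ∀ i, b i ≤ M) {n : ℕ} (h : ∀ i < n, a i = b i) :
    piQ q a - piQ q b = ((a n : ℝ) - b n + (piQ q (shiftSeq (n + 1) a) -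
      piQ q (shiftSeq (n + 1) b))) / q ^ (n + 1) := by
  have hs : ∑ i ∈ Finset.range n, (a i : ℝ) / q ^ (i + 1) =
      ∑ i ∈ Finset.range n, (b i : ℝ) / q ^ (i + 1) :=
    Finset.sum_congr rfl fun i hi => by rw [h i (Finset.mem_range.1 hi)]
  rw [piQ_split hq ha (n + 1), piQ_split hq hb (n + 1), Finset.sum_range_succ,
    Finset.sum_range_succ, hs]
  ring

theorem piQ_const (M : ℕ) {q : ℝ} (hq : 1 < q) : piQ q (fun _ => M) = M / (q - 1) := by
  have hq0 : 0 < q := by linarith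
  have h1 : q - 1 ≠ 0 := by linarith
  have hc := piQ_split (M := M) hq (d := fun _ => M) (fun _ => le_rfl) 1
  have : shiftSeq 1 (fun _ => M) = fun _ => M := rfl
  rw [this] at hc
  simp only [Finset.sum_range_one, zero_add, pow_one] at hc
  field_simp at hc ⊢
  linarith

theorem piQ_refl {M : ℕ} {q : ℝ} (hq : 1 < q) {d : ℕ → ℕ} (hd : ∀ i, d i ≤ M) :
    piQ q (reflSeq M d) = M / (q - 1) - piQ q d := by
  rw [← piQ_const M hq, piQ, piQ, piQ,
    ← (piQ_summable (M := M) hq fun _ => le_rfl).tsum_sub (piQ_summable hq hd)]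
  refine tsum_congr fun i => ?_
  simp only [reflSeq]
  rw [Nat.cast_sub (hd i), sub_div]

theorem piQ_le {M : ℕ} {q : ℝ} (hq : 1 < q) {d : ℕ → ℕ} (hd : ∀ i, d i ≤ M) :
    piQ q d ≤ M / (q - 1) := by
  have := piQ_nonneg hq (reflSeq M d)
  rw [piQ_refl hq hd] at this
  linarith

/-- A digit sequence driven by a bounded sequence of remainders expands the initial remainder. -/
theorem piQ_eq_of_remainders {M : ℕ} {q C : ℝ} (hq : 1 < q) {d : ℕ → ℕ} (hd : ∀ i, d i ≤ M)
    {r : ℕ → ℝ} (hr : ∀ n, |r n| ≤ C) (h : ∀ n, r (n + 1) = q * r n - d n) (m : ℕ) :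
    piQ q (shiftSeq m d) = r m := by
  have hq0 : 0 < q := by linarith
  have hps : ∀ n, ∑ i ∈ Finset.range n, (shiftSeq m d i : ℝ) / q ^ (i + 1) =
      r m - r (m + n) * (q⁻¹) ^ n := by
    intro n
    induction n with
    | zero => simp
    | succ n ih =>
      rw [Finset.sum_range_succ, ih, ← add_assoc, h (m + n)]
      simp only [shiftSeq, inv_pow]
      field_simp
      ring
  have ht := (piQ_summable hq (shiftSeq_le hd m)).hasSum.tendsto_sum_nat
  refine tendsto_nhds_unique ht ?_
  simp_rw [hps]
  have hz : Tendsto (fun n => r (m + n) * (q⁻¹) ^ n) atTop (nhds 0) := by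
    have hg := tendsto_pow_atTop_nhds_zero_of_lt_one (r := q⁻¹) (by positivity)
      (inv_lt_one_of_one_lt₀ hq)
    refine squeeze_zero_norm (fun n => ?_) (a := fun n => C * q⁻¹ ^ n)
      (by simpa only [mul_zero] using hg.const_mul C)
    rw [norm_mul, Real.norm_eq_abs, Real.norm_eq_abs, abs_of_nonneg (a := q⁻¹ ^ n) (by positivity)]
    exact mul_le_mul_of_nonneg_right (hr _) (by positivity)
  simpa using hz.const_sub (r m)

/-- Every point of `[0, M/(q-1)]` has an expansion. -/
theorem exists_expansion {M : ℕ} {q x : ℝ} (hq : 1 < q) (hqM : q ≤ M + 1) (hx0 : 0 ≤ x)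
    (hx : x ≤ M / (q - 1)) : ∃ d, IsExpansion M q x d := by
  have hq1 : 0 < q - 1 := by linarith
  let r : ℕ → ℝ := fun n => Nat.rec x (fun _ s => q * s - (min M ⌊q * s⌋₊ : ℕ)) n
  have hrs : ∀ n, r (n + 1) = q * r n - (min M ⌊q * r n⌋₊ : ℕ) := fun n => rfl
  have hB : (M / (q - 1)) * (q - 1) = M := div_mul_cancel₀ _ hq1.ne'
  have hB1 : 1 ≤ M / (q - 1) := by rw [le_div_iff₀ hq1]; linarith
  have hr : ∀ n, 0 ≤ r n ∧ r n ≤ M / (q - 1) := by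
    intro n
    induction n with
    | zero => exact ⟨hx0, hx⟩
    | succ n ih =>
      obtain ⟨h0, h1⟩ := ih
      have hqr : 0 ≤ q * r n := by positivity
      rw [hrs]
      have hfl := Nat.floor_le hqr
      have hfl' := Nat.lt_floor_add_one (q * r n)
      rcases le_total M ⌊q * r n⌋₊ with h | h
      · rw [min_eq_left h]
        have : (M : ℝ) ≤ ⌊q * r n⌋₊ := by exact_mod_cast h
        refine ⟨by linarith, ?_⟩
        have := mul_le_mul_of_nonneg_left h1 (show 0 ≤ q by linarith)
        nlinarith
      · rw [min_eq_right h]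
        exact ⟨by linarith, by linarith⟩
  refine ⟨fun n => min M ⌊q * r n⌋₊, fun i => min_le_left _ _, ?_⟩
  have := piQ_eq_of_remainders (M := M) (C := M / (q - 1)) hq
    (d := fun n => min M ⌊q * r n⌋₊) (fun i => min_le_left _ _) (r := r)
    (fun n => by rw [abs_of_nonneg (hr n).1]; exact (hr n).2) hrs 0
  rw [shiftSeq_zero] at this
  exact this

theorem reflSeq_mem_univSeqs {M : ℕ} {q : ℝ} (hq : 1 < q) {d : ℕ → ℕ} (hd : d ∈ UnivSeqs M q) :
    reflSeq M d ∈ UnivSeqs M q := by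
  refine ⟨reflSeq_le M d, fun e he => ?_⟩
  have h := hd.2 (reflSeq M e) ⟨reflSeq_le M e, by
    rw [piQ_refl hq he.1, he.2, piQ_refl hq hd.1]; ring⟩
  rw [← reflSeq_reflSeq he.1, h]

theorem piQ_shiftSeq_lt_one_of_mem {M : ℕ} {q : ℝ} (hq : 1 < q) (hqM : q ≤ M + 1) {d : ℕ → ℕ}
    (hd : d ∈ UnivSeqs M q) {n : ℕ} (hn : d n < M) : piQ q (shiftSeq (n + 1) d) < 1 := by
  by_contra! hcon
  obtain ⟨e, he, hev⟩ := exists_expansion (x := piQ q (shiftSeq (n + 1) d) - 1) hq hqM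
    (by linarith) (by linarith [piQ_le hq (shiftSeq_le hd.1 (n + 1))])
  let f : ℕ → ℕ := fun i => if i < n then d i else if i = n then d n + 1 else e (i - (n + 1))
  have hfM : ∀ i, f i ≤ M := by
    intro i
    simp only [f]
    split_ifs
    · exact hd.1 i
    · exact hn
    · exact he _
  have hfn : f n = d n + 1 := by simp [f]
  have hfs : shiftSeq (n + 1) f = e := by
    funext i
    simp only [shiftSeq, f]
    rw [if_neg (by omega), if_neg (by omega)]
    congr 1; omega
  have hv := piQ_sub_of_agree hq hfM hd.1 (n := n) fun i hi => by simp [f, hi]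
  rw [hfs, hev, hfn] at hv
  have h := hd.2 f ⟨hfM, by
    rw [← sub_eq_zero, hv]; push_cast; ring_nf⟩
  rw [h] at hfn
  omega

theorem piQ_lt_of_seqLt {M : ℕ} {q : ℝ} (hq : 1 < q) {d e : ℕ → ℕ} (hd : ∀ i, d i ≤ M)
    (he : ∀ i, e i ≤ M) (h : ∀ n, d n < M → piQ q (shiftSeq (n + 1) d) < 1) (hde : seqLt d e) :
    piQ q d < piQ q e := by
  obtain ⟨n, hn, hn'⟩ := hde
  have hv := piQ_sub_of_agree hq he hd fun i hi => (hn i hi).symm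
  have h1 := h n (hn'.trans_le (he n))
  have h2 := piQ_nonneg hq (shiftSeq (n + 1) e)
  have h3 : (d n : ℝ) + 1 ≤ e n := by exact_mod_cast hn'
  have : 0 < piQ q e - piQ q d := by
    rw [hv]
    have : 0 < q := by linarith
    apply div_pos _ (by positivity)
    linarith
  linarith

theorem mem_univSeqs {M : ℕ} {q : ℝ} (hq : 1 < q) {d : ℕ → ℕ} (hd : ∀ i, d i ≤ M)
    (h : ∀ n, d n < M → piQ q (shiftSeq (n + 1) d) < 1)
    (h' : ∀ n, reflSeq M d n < M → piQ q (shiftSeq (n + 1) (reflSeq M d)) < 1) :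
    d ∈ UnivSeqs M q := by
  refine ⟨hd, fun e he => ?_⟩
  by_contra hne
  by_cases hlt : seqLt d e
  · exact (piQ_lt_of_seqLt hq hd he.1 h hlt).ne he.2.symm
  · rcases eq_or_seqLt_of_not hlt with h1 | h1
    · exact hne h1
    · have := piQ_lt_of_seqLt hq (reflSeq_le M d) (reflSeq_le M e) h' (h1.refl hd)
      rw [piQ_refl hq hd, piQ_refl hq he.1, he.2] at this
      linarith

/-- If the tails of `e` after digits below `M`, and `e` itself, are lexicographically smaller than
an expansion `a` of `1` with positive tails, then `e` has value below `1`. -/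
theorem piQ_lt_one_of_seqLt {M : ℕ} {q : ℝ} (hq : 1 < q) {a : ℕ → ℕ} (ha : ∀ i, a i ≤ M)
    (ha1 : piQ q a = 1) (hpos : ∀ k, 0 < piQ q (shiftSeq k a)) {e : ℕ → ℕ} (he : ∀ i, e i ≤ M)
    (hlt : seqLt e a) (hs : ∀ n, e n < M → seqLt (shiftSeq (n + 1) e) a) : piQ q e < 1 := by
  have hq0 : 0 < q := by linarith
  have key : ∀ e : ℕ → ℕ, (∀ i, e i ≤ M) → seqLt e a →
      (∀ n, e n < M → seqLt (shiftSeq (n + 1) e) a) → ∃ n,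
      ((∀ i, shiftSeq (n + 1) e i ≤ M) ∧ seqLt (shiftSeq (n + 1) e) a ∧
      (∀ k, shiftSeq (n + 1) e k < M → seqLt (shiftSeq (k + 1) (shiftSeq (n + 1) e)) a)) ∧
      ∃ δ > 0, piQ q e - 1 ≤ (piQ q (shiftSeq (n + 1) e) - 1 - δ) / q ^ (n + 1) := by
    intro e he hlt hs
    obtain ⟨n, hn, hn'⟩ := hlt
    refine ⟨n, ⟨shiftSeq_le he _, hs n (hn'.trans_le (ha n)), fun k hk => ?_⟩,
      piQ q (shiftSeq (n + 1) a), hpos _, ?_⟩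
    · rw [shiftSeq_shiftSeq]
      exact hs _ hk
    · rw [← ha1, piQ_sub_of_agree hq he ha hn, ha1]
      have : (e n : ℝ) + 1 ≤ a n := by exact_mod_cast hn'
      gcongr
      linarith
  have bound : ∀ N : ℕ, ∀ e : ℕ → ℕ, (∀ i, e i ≤ M) → seqLt e a →
      (∀ n, e n < M → seqLt (shiftSeq (n + 1) e) a) →
      piQ q e - 1 ≤ (M / (q - 1)) * (q⁻¹) ^ N := by
    intro N
    induction N with
    | zero => intro e he _ _; have := piQ_le hq he; simp; linarith
    | succ N ih =>
      intro e he hlt hs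
      obtain ⟨n, ⟨h1, h2, h3⟩, δ, hδ, h4⟩ := key e he hlt hs
      have h5 := ih _ h1 h2 h3
      have hC : 0 ≤ (M / (q - 1)) * (q⁻¹) ^ N := by
        have : 0 < q - 1 := by linarith
        positivity
      calc piQ q e - 1 ≤ _ := h4
        _ ≤ ((M / (q - 1)) * (q⁻¹) ^ N) / q ^ (n + 1) := by gcongr; linarith
        _ ≤ ((M / (q - 1)) * (q⁻¹) ^ N) / q ^ 1 := by
          gcongr
          · exact hq.le
          · omega
        _ = _ := by rw [pow_succ q⁻¹, pow_one, div_eq_mul_inv]; ring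
  have nonpos : ∀ e : ℕ → ℕ, (∀ i, e i ≤ M) → seqLt e a →
      (∀ n, e n < M → seqLt (shiftSeq (n + 1) e) a) → piQ q e - 1 ≤ 0 := by
    intro e he hlt hs
    have hg := tendsto_pow_atTop_nhds_zero_of_lt_one (r := q⁻¹) (by positivity)
      (inv_lt_one_of_one_lt₀ hq)
    have hg' : Tendsto (fun N => (M / (q - 1)) * (q⁻¹) ^ N) atTop (nhds 0) := by
      simpa using hg.const_mul (M / (q - 1))
    exact ge_of_tendsto' hg' fun N => bound N e he hlt hs
  obtain ⟨n, ⟨h1, h2, h3⟩, δ, hδ, h4⟩ := key e he hlt hs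
  have h5 := nonpos _ h1 h2 h3
  have : (piQ q (shiftSeq (n + 1) e) - 1 - δ) / q ^ (n + 1) < 0 :=
    div_neg_of_neg_of_pos (by linarith) (by positivity)
  linarith

/-! ### The quasi-greedy expansion of `1` -/

/-- Remainders of the quasi-greedy algorithm for `1` in base `q`. -/
def qgRem (q : ℝ) : ℕ → ℝ
  | 0 => 1
  | n + 1 => q * qgRem q n - (⌈q * qgRem q n⌉₊ - 1 : ℕ)

/-- The quasi-greedy expansion of `1` in base `q`. -/
def quasi (q : ℝ) (n : ℕ) : ℕ := ⌈q * qgRem q n⌉₊ - 1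

theorem qgRem_succ (q : ℝ) (n : ℕ) : qgRem q (n + 1) = q * qgRem q n - quasi q n := rfl

theorem quasi_bounds {q x : ℝ} (hx : 0 < q * x) :
    ((⌈q * x⌉₊ - 1 : ℕ) : ℝ) < q * x ∧ q * x ≤ ((⌈q * x⌉₊ - 1 : ℕ) : ℝ) + 1 := by
  have h1 : 0 < ⌈q * x⌉₊ := Nat.ceil_pos.2 hx
  have h2 := Nat.le_ceil (q * x)
  have h3 := Nat.ceil_lt_add_one hx.le
  have h4 : ((⌈q * x⌉₊ - 1 : ℕ) : ℝ) = ⌈q * x⌉₊ - 1 := by rw [Nat.cast_sub h1]; simp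
  rw [h4]
  constructor <;> linarith

theorem qgRem_mem {q : ℝ} (hq : 1 < q) (n : ℕ) : 0 < qgRem q n ∧ qgRem q n ≤ 1 := by
  induction n with
  | zero => simp [qgRem]
  | succ n ih =>
    have h := quasi_bounds (q := q) (x := qgRem q n) (mul_pos (by linarith) ih.1)
    rw [qgRem]
    constructor <;> linarith [h.1, h.2]

theorem quasi_lt {q : ℝ} (hq : 1 < q) (n : ℕ) : (quasi q n : ℝ) < q * qgRem q n :=
  (quasi_bounds (mul_pos (by linarith) (qgRem_mem hq n).1)).1

theorem le_quasi_add_one {q : ℝ} (hq : 1 < q) (n : ℕ) : q * qgRem q n ≤ quasi q n + 1 :=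
  (quasi_bounds (mul_pos (by linarith) (qgRem_mem hq n).1)).2

theorem quasi_le {M : ℕ} {q : ℝ} (hq : 1 < q) (hqM : q ≤ M + 1) (n : ℕ) : quasi q n ≤ M := by
  have h := quasi_lt hq n
  have h' := (qgRem_mem hq n)
  have : (quasi q n : ℝ) < M + 1 := by nlinarith
  exact Nat.lt_succ_iff.1 (by exact_mod_cast this)

theorem quasi_zero_pos {q : ℝ} (hq : 1 < q) : 0 < quasi q 0 := by
  have h := le_quasi_add_one hq 0
  simp only [qgRem, mul_one] at h
  have : (0 : ℝ) < quasi q 0 := by linarith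
  exact_mod_cast this

theorem piQ_shiftSeq_quasi {M : ℕ} {q : ℝ} (hq : 1 < q) (hqM : q ≤ M + 1) (n : ℕ) :
    piQ q (shiftSeq n (quasi q)) = qgRem q n :=
  piQ_eq_of_remainders (C := 1) hq (quasi_le hq hqM)
    (fun n => by rw [abs_of_pos (qgRem_mem hq n).1]; exact (qgRem_mem hq n).2)
    (qgRem_succ q) n

theorem piQ_quasi {M : ℕ} {q : ℝ} (hq : 1 < q) (hqM : q ≤ M + 1) : piQ q (quasi q) = 1 := by
  have := piQ_shiftSeq_quasi hq hqM 0
  rwa [shiftSeq_zero] at this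

/-- The value of a sequence lexicographically larger than `α(q)` exceeds `1` by at least the
contribution of one of its tails. -/
theorem exists_piQ_ge_of_quasi_lt {M : ℕ} {q : ℝ} (hq : 1 < q) (hqM : q ≤ M + 1) {x : ℕ → ℕ}
    (hx : ∀ i, x i ≤ M) (h : seqLt (quasi q) x) :
    ∃ n, 1 + piQ q (shiftSeq n x) / q ^ n ≤ piQ q x := by
  obtain ⟨n, hn, hn'⟩ := h
  have hq0 : 0 < q := by linarith
  have hv := piQ_sub_of_agree hq hx (quasi_le hq hqM) fun i hi => (hn i hi).symm
  rw [piQ_quasi hq hqM, piQ_shiftSeq_quasi hq hqM] at hv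
  have h1 : (quasi q n : ℝ) + 1 ≤ x n := by exact_mod_cast hn'
  have h2 := (qgRem_mem hq (n + 1)).2
  refine ⟨n + 1, ?_⟩
  have : piQ q (shiftSeq (n + 1) x) / q ^ (n + 1) ≤ piQ q x - 1 := by
    rw [hv]; gcongr; linarith
  linarith

theorem one_le_piQ_of_not_seqLt {M : ℕ} {q : ℝ} (hq : 1 < q) (hqM : q ≤ M + 1) {x : ℕ → ℕ}
    (hx : ∀ i, x i ≤ M) (h : ¬ seqLt x (quasi q)) : 1 ≤ piQ q x := by
  rcases eq_or_seqLt_of_not h with rfl | h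
  · exact (piQ_quasi hq hqM).ge
  · obtain ⟨n, hn⟩ := exists_piQ_ge_of_quasi_lt hq hqM hx h
    have : 0 ≤ piQ q (shiftSeq n x) / q ^ n := by
      have := piQ_nonneg hq (shiftSeq n x)
      have : 0 < q := by linarith
      positivity
    linarith

theorem not_quasi_lt_shiftSeq {M : ℕ} {q : ℝ} (hq : 1 < q) (hqM : q ≤ M + 1) (m : ℕ) :
    ¬ seqLt (quasi q) (shiftSeq m (quasi q)) := by
  intro h
  obtain ⟨n, hn⟩ := exists_piQ_ge_of_quasi_lt hq hqM (shiftSeq_le (quasi_le hq hqM) m) h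
  rw [shiftSeq_shiftSeq, piQ_shiftSeq_quasi hq hqM, piQ_shiftSeq_quasi hq hqM] at hn
  have h1 := (qgRem_mem hq (m + n)).1
  have h2 := (qgRem_mem hq m).2
  have : 0 < qgRem q (m + n) / q ^ n := by
    have : 0 < q := by linarith
    positivity
  linarith

theorem seqLt_quasi_of_mem_univSeqs {M : ℕ} {q : ℝ} (hq : 1 < q) (hqM : q ≤ M + 1) {d : ℕ → ℕ}
    (hd : d ∈ UnivSeqs M q) {n : ℕ} (hn : d n < M) : seqLt (shiftSeq (n + 1) d) (quasi q) := by
  by_contra h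
  exact absurd (one_le_piQ_of_not_seqLt hq hqM (shiftSeq_le hd.1 _) h)
    (piQ_shiftSeq_lt_one_of_mem hq hqM hd hn).not_ge

/-- Lexicographic criterion for unique expansions relative to an expansion `a` of `1`. -/
theorem mem_univSeqs_of_seqLt {M : ℕ} {q : ℝ} (hq : 1 < q) {a : ℕ → ℕ} (ha : ∀ i, a i ≤ M)
    (ha1 : piQ q a = 1) (hpos : ∀ k, 0 < piQ q (shiftSeq k a)) {d : ℕ → ℕ} (hd : ∀ i, d i ≤ M)
    (h : ∀ n, d n < M → seqLt (shiftSeq (n + 1) d) a)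
    (h' : ∀ n, reflSeq M d n < M → seqLt (shiftSeq (n + 1) (reflSeq M d)) a) :
    d ∈ UnivSeqs M q := by
  have aux : ∀ d : ℕ → ℕ, (∀ i, d i ≤ M) → (∀ n, d n < M → seqLt (shiftSeq (n + 1) d) a) →
      ∀ n, d n < M → piQ q (shiftSeq (n + 1) d) < 1 := fun d hd h n hn =>
    piQ_lt_one_of_seqLt hq ha ha1 hpos (shiftSeq_le hd _) (h n hn) fun k hk => by
      rw [shiftSeq_shiftSeq]; exact h _ hk
  exact mem_univSeqs hq hd (aux d hd h) (aux _ (reflSeq_le M d) h')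

theorem quasi_eventually_agree {q : ℝ} (hq : 1 < q) (n : ℕ) :
    (∀ᶠ p in nhdsWithin q (Iio q), (∀ i < n, quasi p i = quasi q i) ∧ qgRem p n ≤ qgRem q n) ∧
      Tendsto (fun p => qgRem p n) (nhdsWithin q (Iio q)) (nhds (qgRem q n)) := by
  induction n with
  | zero => simp [qgRem]
  | succ n ih =>
    obtain ⟨h1, h2⟩ := ih
    have hid : Tendsto (fun p : ℝ => p) (nhdsWithin q (Iio q)) (nhds q) :=
      tendsto_id.mono_left nhdsWithin_le_nhds
    have hmul := hid.mul h2
    have hgt := hmul.eventually (lt_mem_nhds (quasi_lt hq n))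
    have hp0 := hid.eventually (lt_mem_nhds (show 0 < q by linarith))
    have hlt : ∀ᶠ p in nhdsWithin q (Iio q), p < q := eventually_mem_nhdsWithin
    have hr := (qgRem_mem hq n).1
    have hle : ∀ᶠ p in nhdsWithin q (Iio q), p * qgRem p n ≤ q * qgRem q n := by
      filter_upwards [h1, hp0, hlt] with p h1 hp0 hlt
      nlinarith [mul_le_mul_of_nonneg_left h1.2 hp0.le]
    have hdig : ∀ᶠ p in nhdsWithin q (Iio q), quasi p n = quasi q n := by
      filter_upwards [hle, hgt] with p hle hgt
      have h4 := le_quasi_add_one hq n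
      have : ⌈p * qgRem p n⌉₊ = quasi q n + 1 := by
        rw [Nat.ceil_eq_iff (by omega)]
        constructor
        · simpa using hgt
        · push_cast; linarith
      rw [quasi, this]; rfl
    constructor
    · filter_upwards [h1, hdig, hle] with p h1 hdig hle
      refine ⟨fun i hi => ?_, ?_⟩
      · rcases Nat.lt_succ_iff_lt_or_eq.1 hi with h | rfl
        · exact h1.1 i h
        · exact hdig
      · rw [qgRem_succ, qgRem_succ, hdig]; linarith
    · rw [qgRem_succ]
      refine (hmul.sub_const _).congr' ?_
      filter_upwards [hdig] with p hdig
      rw [qgRem_succ, hdig]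

theorem quasi_mem_univSeqs {M : ℕ} {q : ℝ} (hq : q ∈ UnivBases M) : quasi q ∈ UnivSeqs M q := by
  obtain ⟨h1, h2, d, -, hd⟩ := hq
  refine ⟨quasi_le h1 h2, fun e he => ?_⟩
  rw [piQ_quasi h1 h2] at he
  rw [hd e he, hd _ ⟨quasi_le h1 h2, piQ_quasi h1 h2⟩]

theorem lt_of_mem_univBases {M : ℕ} {q : ℝ} (hq : q ∈ UnivBases M) : 1 + (M : ℝ) / 2 < q := by
  obtain ⟨h1, h2, -⟩ := id hq
  have hmem := reflSeq_mem_univSeqs h1 (quasi_mem_univSeqs hq)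
  have h0 : reflSeq M (quasi q) 0 < M := by
    have := quasi_zero_pos h1
    have := quasi_le h1 h2 0
    simp only [reflSeq]; omega
  have h3 := piQ_shiftSeq_lt_one_of_mem h1 h2 hmem h0
  rw [← reflSeq_shiftSeq, piQ_refl h1 (shiftSeq_le (quasi_le h1 h2) _),
    piQ_shiftSeq_quasi h1 h2] at h3
  have h4 := (qgRem_mem h1 (0 + 1)).2
  have h5 : (M : ℝ) / (q - 1) < 2 := by linarith
  rw [div_lt_iff₀ (by linarith)] at h5
  linarith

theorem not_quasi_lt_reflSeq_of_mem {M : ℕ} {q : ℝ} (hq : q ∈ UnivBases M) (m : ℕ) :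
    ¬ seqLt (quasi q) (reflSeq M (shiftSeq m (quasi q))) := by
  obtain ⟨h1, h2, -⟩ := id hq
  have hle := quasi_le h1 h2
  have hmem := quasi_mem_univSeqs hq
  have hmem' := reflSeq_mem_univSeqs h1 hmem
  have hd : ∀ n, reflSeq M (quasi q) n < M →
      seqLt (shiftSeq (n + 1) (reflSeq M (quasi q))) (quasi q) :=
    fun n hn => seqLt_quasi_of_mem_univSeqs h1 h2 hmem' hn
  have h0 : reflSeq M (quasi q) 0 < M := by
    have := quasi_zero_pos h1
    have := hle 0
    simp only [reflSeq]; omega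
  have hpos : ∀ m, seqLt (shiftSeq m (shiftSeq 1 (reflSeq M (quasi q)))) (quasi q) :=
    seqLt_shiftSeq_of_forall hle (not_quasi_lt_shiftSeq h1 h2 1) (hd 0 h0)
      (shiftSeq_le (reflSeq_le M _) 1) fun n hn => by
        rw [shiftSeq_shiftSeq]; exact hd _ hn
  rw [reflSeq_shiftSeq]
  cases m with
  | zero =>
    rw [shiftSeq_zero]
    intro h
    have h3 := (hpos 0).trans h
    rw [shiftSeq_zero, ← reflSeq_shiftSeq] at h3
    have h4 := h3.refl (reflSeq_le M _)
    rw [reflSeq_reflSeq hle, reflSeq_reflSeq (shiftSeq_le hle 1)] at h4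
    exact not_quasi_lt_shiftSeq h1 h2 1 h4
  | succ m =>
    have h3 := hpos m
    rw [shiftSeq_shiftSeq, add_comm 1 m] at h3
    exact seqLt_asymm h3

theorem add_one_mem_univBases {M : ℕ} (hM : 0 < M) : (M : ℝ) + 1 ∈ UnivBases M := by
  have hM' : (0 : ℝ) < M := by exact_mod_cast hM
  have hq : (1 : ℝ) < M + 1 := by linarith
  have hv : piQ ((M : ℝ) + 1) (fun _ => M) = 1 := by
    rw [piQ_const M hq, add_sub_cancel_right, div_self hM'.ne']
  have hmem : (fun _ => M) ∈ UnivSeqs M ((M : ℝ) + 1) := by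
    refine mem_univSeqs hq (fun _ => le_rfl) (fun n hn => absurd hn (lt_irrefl _)) fun n _ => ?_
    have : shiftSeq (n + 1) (reflSeq M fun _ => M) = fun _ => 0 := by
      funext i; simp [shiftSeq, reflSeq]
    rw [this]
    simp [piQ]
  refine ⟨hq, le_rfl, fun _ => M, ⟨fun _ => le_rfl, hv⟩, fun e he => hmem.2 e ?_⟩
  rwa [hv]

theorem left_mem_closure_of_CC {M : ℕ} (hM : 0 < M) {a b : ℝ} (h : CC M a b) :
    a ∈ closure (UnivBases M) ∧ b ≤ M + 1 ∧ ∀ q, a < q → q < b → q ∉ UnivBases M := by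
  obtain ⟨hab, hsub, ha, -⟩ := h
  have h1 := (Ioo_subset_Ioo_iff hab).1 (hsub.trans sdiff_subset)
  refine ⟨?_, h1.2, fun q hq hq' hmem => (hsub ⟨hq, hq'⟩).2 (subset_closure hmem)⟩
  rcases h1.1.eq_or_lt with h | h
  · rw [← h]
    exact csInf_mem_closure ⟨_, add_one_mem_univBases hM⟩ ⟨1, fun q hq => hq.1.le⟩
  · by_contra hcon
    exact ha ⟨⟨h, by linarith [h1.2]⟩, hcon⟩

theorem one_lt_of_mem_closure {M : ℕ} (hM : 0 < M) {q : ℝ} (hq : q ∈ closure (UnivBases M)) :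
    1 < q := by
  have : q ∈ Ici (1 + (M : ℝ) / 2) :=
    closure_minimal (fun p hp => (lt_of_mem_univBases hp).le) isClosed_Ici hq
  have hM' : (0 : ℝ) < M := by exact_mod_cast hM
  have h2 : 1 + (M : ℝ) / 2 ≤ q := this
  linarith

/-- At a point of the closure of `U` isolated from the right, `α(q)` dominates the reflections of
its tails. -/
theorem not_quasi_lt_reflSeq {M : ℕ} (hM : 0 < M) {a b : ℝ} (hab : a < b)
    (ha : a ∈ closure (UnivBases M)) (hU : ∀ q, a < q → q < b → q ∉ UnivBases M) (m : ℕ) :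
    ¬ seqLt (quasi a) (reflSeq M (shiftSeq m (quasi a))) := by
  by_cases hmem : a ∈ UnivBases M
  · exact not_quasi_lt_reflSeq_of_mem hmem m
  rintro ⟨n, hn, hn'⟩
  have hagree := (quasi_eventually_agree (one_lt_of_mem_closure hM ha) (m + n + 1)).1
  rw [eventually_nhdsWithin_iff] at hagree
  have hfreq := mem_closure_iff_frequently.1 ha
  obtain ⟨p, hpU, hp, hpb⟩ := (hfreq.and_eventually (hagree.and (gt_mem_nhds hab))).exists
  have hpa : p < a := by
    rcases lt_trichotomy p a with h | rfl | h
    · exact h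
    · exact absurd hpU hmem
    · exact absurd hpU (hU p h hpb)
  obtain ⟨hp, -⟩ := hp hpa
  refine not_quasi_lt_reflSeq_of_mem hpU m ⟨n, fun i hi => ?_, ?_⟩
  · have := hn i hi
    simp only [reflSeq, shiftSeq] at this ⊢
    rw [hp i (by omega), hp (m + i) (by omega), this]
  · simp only [reflSeq, shiftSeq] at hn' ⊢
    rw [hp n (by omega), hp (m + n) (by omega)]
    exact hn'

theorem piQ_lt_one_of_lt {M : ℕ} {p q : ℝ} (hp : 1 < p) (hpq : p < q) {d : ℕ → ℕ}
    (hd : ∀ i, d i ≤ M) (h1 : piQ p d = 1) : piQ q d < 1 := by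
  have hp0 : 0 < p := by linarith
  have hq0 : 0 < q := by linarith
  have : piQ q d ≤ p / q * piQ p d := by
    rw [piQ, piQ, ← tsum_mul_left]
    refine Summable.tsum_le_tsum (fun i => ?_) (piQ_summable (by linarith) hd)
      ((piQ_summable hp hd).mul_left _)
    have h3 : p ^ i ≤ q ^ i := by gcongr
    rw [pow_succ, pow_succ]
    have : p / q * ((d i : ℝ) / (p ^ i * p)) = d i / (p ^ i * q) := by field_simp
    rw [this]
    gcongr
  rw [h1, mul_one] at this
  exact this.trans_lt ((div_lt_one hq0).2 hpq)

theorem quasi_lt_quasi {M : ℕ} {p q : ℝ} (hp : 1 < p) (hpq : p < q) (hqM : q ≤ M + 1) :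
    seqLt (quasi p) (quasi q) := by
  have hpM : p ≤ M + 1 := by linarith
  by_contra h
  have h1 := one_le_piQ_of_not_seqLt (by linarith) hqM (quasi_le hp hpM) h
  have h2 := piQ_lt_one_of_lt hp hpq (quasi_le hp hpM) (piQ_quasi hp hpM)
  linarith

theorem continuousOn_piQ {M : ℕ} {p : ℝ} (hp : 1 < p) {d : ℕ → ℕ} (hd : ∀ i, d i ≤ M) (q : ℝ) :
    ContinuousOn (fun x => piQ x d) (Icc p q) := by
  have hp0 : 0 < p := by linarith
  refine continuousOn_tsum (fun i => ?_) (piQ_summable hp hd) fun i x hx => ?_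
  · refine continuousOn_const.div (continuousOn_pow _) fun x hx => ?_
    have : 0 < x := hp0.trans_le hx.1
    positivity
  · have : p ≤ x := hx.1
    rw [Real.norm_of_nonneg (by have : 0 < x := hp0.trans_le this
                                positivity)]
    gcongr

/-- A sequence that strictly dominates its proper tails and the reflections of all its tails
is the expansion of `1` in a univoque base; hence it cannot lie strictly between the quasi-greedy
expansions at the ends of an interval free of univoque bases. -/
theorem not_between_of_free {M : ℕ} {a b : ℝ} (ha1 : 1 < a) (hab : a < b) (hbM : b ≤ M + 1)
    (hU : ∀ q, a < q → q < b → q ∉ UnivBases M) {θ : ℕ → ℕ} (hθ : ∀ i, θ i ≤ M)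
    (hlo : ∀ i, seqLt (reflSeq M (shiftSeq i θ)) θ) (hhi : ∀ i, 0 < i → seqLt (shiftSeq i θ) θ)
    (haθ : seqLt (quasi a) θ) : ¬ seqLt θ (quasi b) := by
  intro hθb
  have hb1 : 1 < b := by linarith
  have haM : a ≤ M + 1 := by linarith
  have hA : 1 ≤ piQ a θ := one_le_piQ_of_not_seqLt ha1 haM hθ (seqLt_asymm haθ)
  have hB : piQ b θ ≤ 1 := by
    refine (piQ_lt_one_of_seqLt hb1 (quasi_le hb1 hbM) (piQ_quasi hb1 hbM) (fun k => ?_) hθ hθb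
      fun n _ => (hhi _ n.succ_pos).trans hθb).le
    rw [piQ_shiftSeq_quasi hb1 hbM]
    exact (qgRem_mem hb1 k).1
  obtain ⟨q, ⟨haq, hqb⟩, hq⟩ : (1 : ℝ) ∈ (fun x => piQ x θ) '' Icc a b :=
    intermediate_value_Icc' hab.le (continuousOn_piQ ha1 hθ b) ⟨hB, hA⟩
  have hq : piQ q θ = 1 := hq
  have hq1 : 1 < q := by linarith
  have hqM : q ≤ M + 1 := by linarith
  have hpos : ∀ k, 0 < piQ q (shiftSeq k θ) := by
    intro k
    rcases (piQ_nonneg hq1 (shiftSeq k θ)).lt_or_eq with h | h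
    · exact h
    · exfalso
      have h2 := piQ_shiftSeq_quasi (M := M) hq1 hqM 0
      obtain ⟨j, -, hj⟩ := hlo k
      have hz : ∀ i, shiftSeq k θ i = 0 := by
        intro i
        have hs := piQ_summable hq1 (shiftSeq_le hθ k)
        have hq0 : 0 < q := by linarith
        have h0 : HasSum (fun i : ℕ => (shiftSeq k θ i : ℝ) / q ^ (i + 1)) 0 := by
          have := hs.hasSum
          rwa [← piQ, ← h] at this
        have h3 := congrFun ((hasSum_zero_iff_of_nonneg fun i => by positivity).1 h0) i
        have h4 : (shiftSeq k θ i : ℝ) / q ^ (i + 1) = 0 := h3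
        rw [div_eq_zero_iff] at h4
        rcases h4 with h4 | h4
        · exact_mod_cast h4
        · exact absurd h4 (by positivity)
      have := hθ j
      simp only [reflSeq, hz j] at hj
      omega
  have hmem : θ ∈ UnivSeqs M q := by
    refine mem_univSeqs_of_seqLt hq1 hθ hq hpos hθ (fun n _ => hhi _ n.succ_pos) fun n _ => ?_
    rw [← reflSeq_shiftSeq]
    exact hlo _
  have hqU : q ∈ UnivBases M :=
    ⟨hq1, hqM, θ, ⟨hθ, hq⟩, fun e he => hmem.2 e (by rwa [hq])⟩
  have hqe : quasi q = θ :=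
    hmem.2 _ ⟨quasi_le hq1 hqM, by rw [hq]; exact piQ_quasi hq1 hqM⟩
  rcases haq.eq_or_lt with rfl | haq
  · rw [hqe] at haθ; exact seqLt_irrefl _ haθ
  rcases hqb.eq_or_lt with rfl | hqb
  · rw [hqe] at hθb; exact seqLt_irrefl _ hθb
  exact hU q haq hqb hqU

/-! ### Thue–Morse type sequences -/

/-- The word `θ_0 ⋯ θ_{2L-1}` is `(u \overline{u})⁺` with `u = θ_0 ⋯ θ_{L-1}`. -/
def DoublesAt (M : ℕ) (θ : ℕ → ℕ) (L : ℕ) : Prop :=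
  ∀ i < L, θ (L + i) = M - θ i + if i + 1 = L then 1 else 0

/-- The prefix `u` of length `L` of `θ` satisfies
`\overline{u_1 ⋯ u_{L-i}} < u_{i+1} ⋯ u_L ≤ u_1 ⋯ u_{L-i}`. -/
def AdmissibleUpto (M : ℕ) (θ : ℕ → ℕ) (L : ℕ) : Prop :=
  ∀ i < L, ltUpto (L - i) (reflSeq M θ) (shiftSeq i θ) ∧
    (0 < i → ltUpto (L - i) (shiftSeq i θ) θ ∨ eqUpto (L - i) (shiftSeq i θ) θ)

/-- Replace the tail of `x` from `L` on so that the result doubles at `L`. -/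
def dblSeq (M L : ℕ) (x : ℕ → ℕ) : ℕ → ℕ := fun i =>
  if i < L then x i else M - x (i - L) + if i + 1 = L + L then 1 else 0

/-- Successive doublings of the prefix of length `n` of `u`. -/
def tmApprox (M n : ℕ) (u : ℕ → ℕ) : ℕ → ℕ → ℕ
  | 0 => u
  | k + 1 => dblSeq M (n * 2 ^ k) (tmApprox M n u k)

/-- The limit of the successive doublings of the prefix of length `n` of `u`. -/
def tmSeq (M n : ℕ) (u : ℕ → ℕ) : ℕ → ℕ := fun i => tmApprox M n u (i + 1) i

theorem tmApprox_add {M n : ℕ} (u : ℕ → ℕ) {i k : ℕ} (hi : i < n * 2 ^ k) (j : ℕ) :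
    tmApprox M n u (k + j) i = tmApprox M n u k i := by
  induction j with
  | zero => rfl
  | succ j ih =>
    rw [← ih, ← add_assoc, tmApprox, dblSeq, if_pos]
    exact hi.trans_le (Nat.mul_le_mul_left _ (Nat.pow_le_pow_right (by norm_num) (by omega)))

theorem tmSeq_eq {M n : ℕ} (hn : 0 < n) (u : ℕ → ℕ) {i k : ℕ} (hi : i < n * 2 ^ k) :
    tmSeq M n u i = tmApprox M n u k i := by
  have hi' : i < n * 2 ^ (i + 1) :=
    calc i < 2 ^ i := Nat.lt_two_pow_self
      _ ≤ 2 ^ (i + 1) := Nat.pow_le_pow_right (by norm_num) (by omega)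
      _ ≤ n * 2 ^ (i + 1) := Nat.le_mul_of_pos_left _ hn
  rw [tmSeq, ← tmApprox_add u hi' k, ← tmApprox_add u hi (i + 1), add_comm]

theorem tmSeq_prefix {M n : ℕ} (hn : 0 < n) (u : ℕ → ℕ) : eqUpto n (tmSeq M n u) u :=
  fun i hi => tmSeq_eq hn u (k := 0) (by simpa using hi)

theorem tmSeq_doublesAt {M n : ℕ} (hn : 0 < n) (u : ℕ → ℕ) (k : ℕ) :
    DoublesAt M (tmSeq M n u) (n * 2 ^ k) := by
  intro i hi
  rw [tmSeq_eq hn u hi, tmSeq_eq hn u (i := n * 2 ^ k + i) (k := k + 1)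
    (by rw [pow_succ, ← mul_assoc]; omega),
    tmApprox, dblSeq, if_neg (by omega), Nat.add_sub_cancel_left]
  congr 1
  exact if_congr (by omega) rfl rfl

theorem le_of_doublesAt {M n : ℕ} (hn : 0 < n) {θ : ℕ → ℕ} (hd : ∀ k, DoublesAt M θ (n * 2 ^ k))
    (h0 : ∀ i < n, θ i ≤ M) (hlast : 0 < θ (n - 1)) (i : ℕ) : θ i ≤ M := by
  have key : ∀ k, (∀ i < n * 2 ^ k, θ i ≤ M) ∧ 0 < θ (n * 2 ^ k - 1) := by
    intro k
    induction k with
    | zero => simpa using ⟨h0, hlast⟩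
    | succ k ih =>
      have hL : 0 < n * 2 ^ k := by positivity
      have hdL := hd k
      have h2 : n * 2 ^ (k + 1) = n * 2 ^ k + n * 2 ^ k := by rw [pow_succ]; ring
      rw [h2]
      generalize n * 2 ^ k = L at *
      obtain ⟨ih1, ih2⟩ := ih
      constructor
      · intro i hi
        by_cases hiL : i < L
        · exact ih1 i hiL
        · have h := hdL (i - L) (by omega)
          rw [Nat.add_sub_cancel' (by omega)] at h
          split_ifs at h with h'
          · have h3 := ih1 (i - L) (by omega)
            rw [show L - 1 = i - L by omega] at ih2
            omega
          · omega
      · have h := hdL (L - 1) (by omega)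
        rw [if_pos (by omega), show L + (L - 1) = L + L - 1 by omega] at h
        omega
  refine (key i).1 i ?_
  calc i < 2 ^ i := Nat.lt_two_pow_self
    _ ≤ n * 2 ^ i := Nat.le_mul_of_pos_left _ hn

/-- Proper tails of the doubled word are strictly smaller than the word itself. -/
theorem AdmissibleUpto.shift_lt {M L : ℕ} {θ : ℕ → ℕ}
    (hd : DoublesAt M θ L) (h : AdmissibleUpto M θ L) {i : ℕ} (hi : i < L) (hi0 : 0 < i) :
    ltUpto L (shiftSeq i θ) θ := by
  rcases (h i hi).2 hi0 with h1 | h1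
  · exact h1.mono (by omega)
  · obtain ⟨j, hj, h2, h3⟩ := (h (L - i) (by omega)).1
    have hs : ∀ k < i, shiftSeq (L - i) (shiftSeq i θ) k = reflSeq M θ k := by
      intro k hk
      have := hd k (by omega)
      rw [if_neg (by omega)] at this
      simp only [shiftSeq, reflSeq]
      rw [show i + (L - i + k) = L + k by omega, this, add_zero]
    have h4 : ltUpto i (shiftSeq (L - i) (shiftSeq i θ)) (shiftSeq (L - i) θ) :=
      ⟨j, by omega, fun k hk => by rw [hs k (by omega), h2 k hk], by
        rw [hs j (by omega)]; exact h3⟩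
    exact (h1.append_ltUpto h4).mono (by omega)

theorem AdmissibleUpto.double {M L : ℕ} {θ : ℕ → ℕ} (hθ : ∀ i, θ i ≤ M)
    (hd : DoublesAt M θ L) (h : AdmissibleUpto M θ L) : AdmissibleUpto M θ (L + L) := by
  intro i hi
  by_cases hiL : i < L
  · exact ⟨(h i hiL).1.mono (by omega), fun hi0 => Or.inl ((h.shift_lt hd hiL hi0).mono (by omega))⟩
  · obtain ⟨j, rfl⟩ : ∃ j, i = L + j := ⟨i - L, by omega⟩
    obtain ⟨l, hl⟩ : ∃ l, L = j + (l + 1) := ⟨L - j - 1, by omega⟩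
    have hlen : L + L - (L + j) = l + 1 := by omega
    have hlen' : L - j = l + 1 := by omega
    rw [hlen]
    have hlow : ∀ k < l, shiftSeq (L + j) θ k = reflSeq M (shiftSeq j θ) k := by
      intro k hk
      have := hd (j + k) (by omega)
      rw [if_neg (by omega)] at this
      simp only [shiftSeq, reflSeq]
      rw [add_assoc, this, add_zero]
    have hlast : shiftSeq (L + j) θ l = reflSeq M (shiftSeq j θ) l + 1 := by
      have := hd (j + l) (by omega)
      rw [if_pos (by omega)] at this
      simp only [shiftSeq, reflSeq]
      rw [add_assoc, this]
    have hj := h j (by omega)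
    rw [hlen'] at hj
    constructor
    · refine ltUpto_of_incr_last (a := reflSeq M θ) (b := reflSeq M (shiftSeq j θ)) ?_
        (fun _ _ => rfl) le_rfl hlow (by omega)
      rcases Nat.eq_zero_or_pos j with rfl | hj0
      · rw [shiftSeq_zero]; exact Or.inr fun _ _ => rfl
      · exact (hj.2 hj0).imp (fun h => h.refl hθ) fun h => h.refl
    · intro _
      refine ltUpto.incr_last (a := reflSeq M (shiftSeq j θ)) ?_ hlow hlast
      have := hj.1.refl (shiftSeq_le hθ j)
      rwa [reflSeq_reflSeq hθ] at this

/-- Bundled data of the Thue–Morse type sequence `θ = lim gⁿ(t)`, where `t⁺` is the prefix of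
length `n` of `θ`. -/
structure IsTMSeq (M n : ℕ) (θ : ℕ → ℕ) : Prop where
  pos : 0 < n
  le : ∀ i, θ i ≤ M
  doubles : ∀ k, DoublesAt M θ (n * 2 ^ k)
  adm : AdmissibleUpto M θ n

theorem IsTMSeq.admissible {M n : ℕ} {θ : ℕ → ℕ} (h : IsTMSeq M n θ) (k : ℕ) :
    AdmissibleUpto M θ (n * 2 ^ k) := by
  induction k with
  | zero => simpa using h.adm
  | succ k ih =>
    rw [show n * 2 ^ (k + 1) = n * 2 ^ k + n * 2 ^ k by rw [pow_succ]; ring]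
    exact ih.double h.le (h.doubles k)

theorem IsTMSeq.lt_len {M n : ℕ} {θ : ℕ → ℕ} (h : IsTMSeq M n θ) (i : ℕ) : i < n * 2 ^ i :=
  calc i < 2 ^ i := Nat.lt_two_pow_self
    _ ≤ n * 2 ^ i := Nat.le_mul_of_pos_left _ h.pos

theorem IsTMSeq.refl_shift_lt {M n : ℕ} {θ : ℕ → ℕ} (h : IsTMSeq M n θ) (i : ℕ) :
    seqLt (reflSeq M (shiftSeq i θ)) θ := by
  have := (h.admissible i i (h.lt_len i)).1.seqLt.refl (shiftSeq_le h.le i)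
  rwa [reflSeq_reflSeq h.le] at this

theorem IsTMSeq.shift_lt {M n : ℕ} {θ : ℕ → ℕ} (h : IsTMSeq M n θ) (i : ℕ) (hi : 0 < i) :
    seqLt (shiftSeq i θ) θ :=
  ((h.admissible i).shift_lt (h.doubles i) (h.lt_len i) hi).seqLt

/-- If the prefix `t` of length `n` of `α` is unbordered, `t⁺` starts a Thue–Morse type
sequence. -/
theorem exists_isTMSeq {M n : ℕ} {α : ℕ → ℕ} (hα : ∀ i, α i ≤ M)
    (hrefl : ∀ m, ¬ seqLt α (reflSeq M (shiftSeq m α))) (hlast : α n < M)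
    (hunb : ∀ i, 0 < i → i < n + 1 → ltUpto (n + 1 - i) (shiftSeq i α) α) :
    ∃ θ, IsTMSeq M (n + 1) θ ∧ eqUpto n θ α ∧ θ n = α n + 1 := by
  let u : ℕ → ℕ := fun i => if i = n then α i + 1 else α i
  have hpre := tmSeq_prefix (M := M) n.succ_pos u
  have h1 : eqUpto n (tmSeq M (n + 1) u) α := fun i hi => by
    rw [hpre i (by omega)]; simp [u, hi.ne]
  have h2 : tmSeq M (n + 1) u n = α n + 1 := by rw [hpre n (by omega)]; simp [u]
  have hd := tmSeq_doublesAt (M := M) n.succ_pos u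
  generalize tmSeq M (n + 1) u = θ at *
  have hle := le_of_doublesAt n.succ_pos hd (fun i hi => by
    rcases Nat.lt_succ_iff_lt_or_eq.1 hi with h | rfl
    · rw [h1 i h]; exact hα i
    · rw [h2]; exact hlast) (by simp only [Nat.succ_sub_one, h2]; omega)
  refine ⟨θ, ⟨n.succ_pos, hle, hd, fun i hi => ?_⟩, h1, h2⟩
  obtain ⟨l, hl⟩ : ∃ l, n = i + l := ⟨n - i, by omega⟩
  have hlen : n + 1 - i = l + 1 := by omega
  have hlow : ∀ k < l, shiftSeq i θ k = shiftSeq i α k := fun k hk => h1 _ (by omega)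
  have hlst : shiftSeq i θ l = shiftSeq i α l + 1 := by
    simp only [shiftSeq]; rw [← hl, h2]
  rw [hlen]
  constructor
  · refine ltUpto_of_incr_last (a := reflSeq M α) (b := shiftSeq i α) ?_ (fun k hk => ?_) ?_
      hlow (by omega)
    · have := ltUpto_or_eqUpto_of_not (hrefl i) (l + 1)
      rcases this with h | h
      · left
        have := h.refl hα
        rwa [reflSeq_reflSeq (shiftSeq_le hα i)] at this
      · right
        have := (h.refl (M := M))
        rwa [reflSeq_reflSeq (shiftSeq_le hα i)] at this
    · simp only [reflSeq]; rw [h1 k (by omega)]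
    · simp only [reflSeq]
      rcases Nat.lt_or_ge l n with h | h
      · rw [h1 l h]
      · obtain rfl : l = n := by omega
        omega
  · intro hi0
    have := hunb i hi0 hi
    rw [hlen] at this
    rcases this.incr_last hlow hlst with h | h
    · left
      obtain ⟨j, hj, h3, h4⟩ := h
      exact ⟨j, hj, fun k hk => by rw [h3 k hk, h1 k (by omega)], by rwa [h1 j (by omega)]⟩
    · exact Or.inr fun k hk => by rw [h k hk, h1 k (by omega)]

/-! ### Unbordered prefixes -/

/-- A sequence strictly larger than its proper tails has arbitrarily long unbordered prefixes. -/
theorem exists_unbordered_prefix {α : ℕ → ℕ} (h : ∀ p, 0 < p → seqLt (shiftSeq p α) α) (N : ℕ) :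
    ∃ n ≥ N, (∃ j, α n < α j) ∧
      ∀ i, 0 < i → i < n + 1 → ltUpto (n + 1 - i) (shiftSeq i α) α := by
  classical
  have hex : ∃ p, 0 < p ∧ ∀ i, p + i < N → α (p + i) = α i :=
    ⟨N + 1, by omega, fun i hi => by omega⟩
  obtain ⟨hp0, hper⟩ := Nat.find_spec hex
  have hmin := fun m hm => Nat.find_min hex (m := m) hm
  generalize Nat.find hex = p at *
  obtain ⟨j, hj, hj'⟩ := h p hp0
  simp only [shiftSeq] at hj hj'
  have hN : N ≤ p + j := by
    by_contra hcon
    have := hper j (by omega)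
    omega
  refine ⟨p + j, hN, ⟨j, hj'⟩, fun i hi0 hi => ?_⟩
  rcases ltUpto_or_eqUpto_of_not (seqLt_asymm (h i hi0)) (p + j + 1 - i) with h1 | h1
  · exact h1
  · exfalso
    have h1 : ∀ k < p + j + 1 - i, α (i + k) = α k := h1
    rcases lt_trichotomy i p with hip | rfl | hip
    · exact hmin i hip ⟨hi0, fun k hk => h1 k (by omega)⟩
    · have := h1 j (by omega); omega
    · refine seqLt_asymm (h (i - p) (by omega)) ⟨p + j - i, fun k hk => ?_, ?_⟩
      · have h2 := h1 k (by omega)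
        have h3 := hj (i - p + k) (by omega)
        rw [show p + (i - p + k) = i + k by omega] at h3
        simp only [shiftSeq]
        rw [← h3, h2]
      · have h2 := h1 (p + j - i) (by omega)
        simp only [shiftSeq]
        rw [show i - p + (p + j - i) = j by omega, ← h2, show i + (p + j - i) = p + j by omega]
        exact hj'

/-- The minimal period of a periodic sequence weakly larger than its tails is unbordered. -/
theorem unbordered_of_min_period {α : ℕ → ℕ} (h : ∀ m, ¬ seqLt α (shiftSeq m α)) {p : ℕ}
    (hp : shiftSeq p α = α) (hmin : ∀ k, 0 < k → k < p → shiftSeq k α ≠ α) (i : ℕ) (hi0 : 0 < i)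
    (hi : i < p) : ltUpto (p - i) (shiftSeq i α) α := by
  rcases ltUpto_or_eqUpto_of_not (h i) (p - i) with h1 | h1
  · exact h1
  · exfalso
    refine hmin (p - i) (by omega) (by omega) ?_
    rcases eq_or_seqLt_of_not (h (p - i)) with h2 | ⟨j, h2, h3⟩
    · exact h2
    · exfalso
      have hs : ∀ k, shiftSeq (p - i) (shiftSeq i α) k = α k := fun k => by
        rw [shiftSeq_shiftSeq, show i + (p - i) = p by omega, hp]
      refine h i (eqUpto.append_ltUpto (m := p - i) (l := j + 1) (fun k hk => (h1 k hk).symm)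
        ⟨j, j.lt_succ_self, fun k hk => ?_, ?_⟩).seqLt
      · rw [hs]; exact h2 k hk
      · rw [hs]; exact h3

/-- In an interval to the right of `a` free of univoque bases, `α(a)` is periodic and `α(b)` is at
most the Thue–Morse type sequence generated by its period. -/
theorem exists_tmSeq_of_free {M : ℕ} (hM : 0 < M) {a b : ℝ} (hab : a < b) (hbM : b ≤ M + 1)
    (ha : a ∈ closure (UnivBases M)) (hU : ∀ q, a < q → q < b → q ∉ UnivBases M) :
    ∃ n θ, IsTMSeq M (n + 1) θ ∧ eqUpto n θ (quasi a) ∧ θ n = quasi a n + 1 ∧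
      shiftSeq (n + 1) (quasi a) = quasi a ∧ ¬ seqLt θ (quasi b) := by
  classical
  have ha1 := one_lt_of_mem_closure hM ha
  have haM : a ≤ M + 1 := by linarith
  have hle : ∀ i, quasi a i ≤ M := quasi_le ha1 haM
  have hmax : ∀ m, ¬ seqLt (quasi a) (shiftSeq m (quasi a)) := not_quasi_lt_shiftSeq ha1 haM
  have hrefl := not_quasi_lt_reflSeq hM hab ha hU
  have hstrict := quasi_lt_quasi ha1 hab hbM
  have hfree : ∀ {n θ}, IsTMSeq M (n + 1) θ → eqUpto n θ (quasi a) → θ n = quasi a n + 1 →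
      ¬ seqLt θ (quasi b) := fun {n θ} h h1 h2 =>
    not_between_of_free ha1 hab hbM hU h.le h.refl_shift_lt h.shift_lt
      ⟨n, fun i hi => (h1 i hi).symm, by omega⟩
  by_cases hper : ∃ p, 0 < p ∧ shiftSeq p (quasi a) = quasi a
  · obtain ⟨hp0, hp⟩ := Nat.find_spec hper
    have hmin := fun m hm => Nat.find_min hper (m := m) hm
    generalize Nat.find hper = p at *
    obtain ⟨n, rfl⟩ : ∃ n, p = n + 1 := ⟨p - 1, by omega⟩
    have hlast : quasi a n < M := by
      refine (hle n).lt_of_ne fun hn => ?_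
      have hM0 : ∀ i, ¬ (quasi a) i < M := by
        have hall : ∀ i, quasi a i = M := by
          have h0 : quasi a 0 = M := by
            by_contra h0
            have := hle 0
            exact hmax n ⟨0, by simp, by simp only [shiftSeq, add_zero]; omega⟩
          have h1 : shiftSeq 1 (quasi a) = quasi a := by
            rcases eq_or_seqLt_of_not (hmax 1) with h | ⟨j, h, h'⟩
            · exact h
            · refine absurd ?_ (hmax n)
              refine ⟨j + 1, fun i hi => ?_, ?_⟩
              · cases i with
                | zero => simp [shiftSeq, h0, hn]
                | succ i =>
                  have h3 := h i (by omega)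
                  have h4 := congrFun hp i
                  simp only [shiftSeq] at h3 h4 ⊢
                  rw [show n + (i + 1) = n + 1 + i by ring, h4, ← h3, add_comm 1 i]
              · have h4 := congrFun hp j
                simp only [shiftSeq] at h' h4 ⊢
                rw [show n + (j + 1) = n + 1 + j by ring, h4, add_comm j 1]
                exact h'
          intro i
          induction i with
          | zero => exact h0
          | succ i ih =>
            have := congrFun h1 i
            simp only [shiftSeq] at this
            rw [add_comm i 1, this, ih]
        intro i; rw [hall i]; exact lt_irrefl _
      obtain ⟨j, -, hj⟩ := hstrict
      exact hM0 j (hj.trans_le (quasi_le (ha1.trans hab) hbM j))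
    obtain ⟨θ, h1, h2, h3⟩ := exists_isTMSeq hle hrefl hlast
      (unbordered_of_min_period hmax hp fun k hk hkn hk' => hmin k hkn ⟨hk, hk'⟩)
    exact ⟨n, θ, h1, h2, h3, hp, hfree h1 h2 h3⟩
  · exfalso
    push Not at hper
    have hlt : ∀ p, 0 < p → seqLt (shiftSeq p (quasi a)) (quasi a) := fun p hp =>
      (eq_or_seqLt_of_not (hmax p)).resolve_left (hper p hp)
    obtain ⟨j, hj, hj'⟩ := hstrict
    obtain ⟨n, hn, ⟨k, hk⟩, hunb⟩ := exists_unbordered_prefix hlt (j + 1)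
    obtain ⟨θ, h1, h2, h3⟩ := exists_isTMSeq hle hrefl (hk.trans_le (hle k)) hunb
    exact hfree h1 h2 h3 ⟨j, fun i hi => by rw [h2 i (by omega), hj i hi], by
      rwa [h2 j (by omega)]⟩

/-- Sequences all of whose tails lie strictly between `\overline{θ}` and `θ`. -/
def boundedShift (M : ℕ) (θ : ℕ → ℕ) : Set (ℕ → ℕ) :=
  {e | (∀ i, e i ≤ M) ∧ ∀ m, seqLt (shiftSeq m e) θ ∧ seqLt (reflSeq M (shiftSeq m e)) θ}

theorem shiftSeq_mem_boundedShift {M : ℕ} {θ e : ℕ → ℕ} (he : e ∈ boundedShift M θ) (m : ℕ) :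
    shiftSeq m e ∈ boundedShift M θ :=
  ⟨shiftSeq_le he.1 m, fun k => by rw [shiftSeq_shiftSeq]; exact he.2 _⟩

theorem reflSeq_mem_boundedShift {M : ℕ} {θ e : ℕ → ℕ} (he : e ∈ boundedShift M θ) :
    reflSeq M e ∈ boundedShift M θ :=
  ⟨reflSeq_le M e, fun k => ⟨(he.2 k).2, by
    rw [← reflSeq_shiftSeq, reflSeq_reflSeq (shiftSeq_le he.1 k)]; exact (he.2 k).1⟩⟩

/-- A tail of a sequence of `U'_b ∖ U'_a`, or its reflection, lies in the bounded shift and is at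
least `α(a)`. -/
theorem exists_tail_mem_boundedShift {M : ℕ} {a b : ℝ} (ha1 : 1 < a) (hab : a < b)
    (hbM : b ≤ M + 1) {θ : ℕ → ℕ} (hθ : ∀ i, θ i ≤ M) (hθ1 : ¬ seqLt θ (shiftSeq 1 θ))
    (hrefl : ¬ seqLt (quasi a) (reflSeq M (quasi a))) (haθ : seqLt (quasi a) θ)
    (hbθ : ¬ seqLt θ (quasi b)) {d : ℕ → ℕ} (hd : d ∈ UnivSeqs M b \ UnivSeqs M a) :
    ∃ N e, (e = shiftSeq N d ∨ e = reflSeq M (shiftSeq N d)) ∧ e ∈ boundedShift M θ ∧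
      ¬ seqLt e (quasi a) := by
  have hb1 : 1 < b := by linarith
  have haM : a ≤ M + 1 := by linarith
  have hle := quasi_le ha1 haM
  have main : ∀ d ∈ UnivSeqs M b, ∀ n, d n < M → ¬ seqLt (shiftSeq (n + 1) d) (quasi a) →
      shiftSeq (n + 1) d ∈ boundedShift M θ := by
    intro d hd n hn hge
    have hdM := hd.1
    have hd' := reflSeq_mem_univSeqs hb1 hd
    have hup : ∀ k, d k < M → seqLt (shiftSeq (k + 1) d) θ := fun k hk =>
      (seqLt_quasi_of_mem_univSeqs hb1 hbM hd hk).trans_not hbθ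
    have hup' : ∀ k, reflSeq M d k < M → seqLt (shiftSeq (k + 1) (reflSeq M d)) θ := fun k hk =>
      (seqLt_quasi_of_mem_univSeqs hb1 hbM hd' hk).trans_not hbθ
    have h0 : 0 < d (n + 1) := by
      by_contra h0
      refine hge ⟨0, by simp, ?_⟩
      simp only [shiftSeq, add_zero]
      have := quasi_zero_pos ha1
      omega
    have h1 : ∀ m, seqLt (shiftSeq m (shiftSeq (n + 1) d)) θ :=
      seqLt_shiftSeq_of_forall hθ hθ1 (hup n hn) (shiftSeq_le hdM _) fun k hk => by
        rw [shiftSeq_shiftSeq]; exact hup _ hk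
    have h2 : ∀ m, seqLt (shiftSeq m (shiftSeq (n + 1 + 1) (reflSeq M d))) θ :=
      seqLt_shiftSeq_of_forall hθ hθ1
        (hup' (n + 1) (by have := hdM (n + 1); simp only [reflSeq]; omega))
        (shiftSeq_le (reflSeq_le M d) _) fun k hk => by
          rw [shiftSeq_shiftSeq]; exact hup' _ hk
    refine ⟨shiftSeq_le hdM _, fun m => ⟨h1 m, ?_⟩⟩
    cases m with
    | zero =>
      rw [shiftSeq_zero]
      have h3 : ¬ seqLt (reflSeq M (quasi a)) (reflSeq M (shiftSeq (n + 1) d)) := by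
        intro h
        have := h.refl (reflSeq_le M _)
        rw [reflSeq_reflSeq hle, reflSeq_reflSeq (shiftSeq_le hdM _)] at this
        exact hge this
      exact seqLt_of_not_of_lt h3 (seqLt_of_not_of_lt hrefl haθ)
    | succ m =>
      have := h2 m
      rw [shiftSeq_shiftSeq] at this ⊢
      rw [reflSeq_shiftSeq, show n + 1 + (m + 1) = n + 1 + 1 + m by ring]
      exact this
  obtain ⟨hdb, hda⟩ := hd
  have : (∃ n, d n < M ∧ ¬ seqLt (shiftSeq (n + 1) d) (quasi a)) ∨
      ∃ n, reflSeq M d n < M ∧ ¬ seqLt (shiftSeq (n + 1) (reflSeq M d)) (quasi a) := by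
    by_contra! hcon
    refine hda (mem_univSeqs_of_seqLt ha1 hle (piQ_quasi ha1 haM) (fun k => ?_) hdb.1
      hcon.1 hcon.2)
    rw [piQ_shiftSeq_quasi ha1 haM]
    exact (qgRem_mem ha1 k).1
  rcases this with ⟨n, hn, h⟩ | ⟨n, hn, h⟩
  · exact ⟨n + 1, _, Or.inl rfl, main d hdb n hn h, h⟩
  · exact ⟨n + 1, _, Or.inr (reflSeq_shiftSeq M _ d), main _ (reflSeq_mem_univSeqs hb1 hdb) n hn h,
      h⟩

theorem mem_range_periodicSeq {e : ℕ → ℕ} {p : ℕ} (hp : 0 < p) {w : ℕ → ℕ}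
    (h : ∀ i, e i = w (i % p)) : e ∈ range periodicSeq := by
  refine ⟨(List.range p).map w, funext fun i => ?_⟩
  have := Nat.mod_lt i hp
  simp [periodicSeq, h i, this]

/-- A sequence of the bounded shift that is at least the periodic sequence `t^∞` equals it or has
a tail starting with `t⁺`. -/
theorem eq_or_exists_eqUpto {M n : ℕ} {θ α e : ℕ → ℕ} (h1 : eqUpto n θ α) (h2 : θ n = α n + 1)
    (hper : shiftSeq (n + 1) α = α) (he : e ∈ boundedShift M θ) (hge : ¬ seqLt e α) :
    e = α ∨ ∃ m, eqUpto (n + 1) (shiftSeq m e) θ := by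
  rcases eq_or_seqLt_of_not hge with h | ⟨j, hj, hj'⟩
  · exact Or.inl h.symm
  · right
    have hper' : ∀ k i, α ((n + 1) * k + i) = α i := by
      intro k
      induction k with
      | zero => simp
      | succ k ih =>
        intro i
        have := congrFun hper ((n + 1) * k + i)
        simp only [shiftSeq] at this
        rw [← ih i, ← this]; congr 1; ring
    set m := (n + 1) * (j / (n + 1)) with hm
    have hdm : m + j % (n + 1) = j := Nat.div_add_mod j (n + 1)
    have hlt := Nat.mod_lt j n.succ_pos
    generalize j % (n + 1) = r at *
    have hα : ∀ i, α (m + i) = α i := hper' _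
    have ha : ∀ i < r, e (m + i) = α i := fun i hi => by rw [← hj (m + i) (by omega), hα]
    have hb : α r < e (m + r) := by rw [hdm, ← hα r, hdm]; exact hj'
    have hltθ := (he.2 m).1
    refine ⟨m, ?_⟩
    by_contra hcon
    refine seqLt_asymm hltθ ?_
    rcases Nat.lt_or_ge r n with hr | hr
    · exact ⟨r, fun i hi => by rw [h1 i (by omega), ← ha i hi]; rfl, by rw [h1 r hr]; exact hb⟩
    · obtain rfl : r = n := by omega
      refine ⟨r, fun i hi => by rw [h1 i (by omega), ← ha i hi]; rfl, ?_⟩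
      rw [h2]
      refine lt_of_le_of_ne hb fun heq => hcon fun i hi => ?_
      rcases Nat.lt_succ_iff_lt_or_eq.1 hi with h | rfl
      · rw [h1 i h, ← ha i h]; rfl
      · rw [h2]; exact heq.symm

/-- After the word `u = θ_0 ⋯ θ_{L-1}` comes `\overline{u}`, or `u` extends to the doubled word. -/
theorem eqUpto_refl_or_double {M L : ℕ} {θ f : ℕ → ℕ} (hL : 0 < L) (hd : DoublesAt M θ L)
    (hf : f ∈ boundedShift M θ) (h : eqUpto L f θ) :
    eqUpto L (reflSeq M (shiftSeq L f)) θ ∨ eqUpto (L + L) f θ := by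
  have h1 := (hf.2 L).2
  have h2 := (hf.2 0).1
  rw [shiftSeq_zero] at h2
  rcases ltUpto_or_eqUpto_of_not (seqLt_asymm h1) L with h3 | h3
  · right
    obtain ⟨l, rfl⟩ : ∃ l, L = l + 1 := ⟨L - 1, by omega⟩
    by_cases hθM : ∀ i < l + 1, θ i ≤ M
    · have h3 : ltUpto (l + 1) (reflSeq M θ) (shiftSeq (l + 1) f) := by
        obtain ⟨j, hj, h4, h5⟩ := h3
        refine ⟨j, hj, fun i hi => ?_, ?_⟩
        · have h6 := h4 i hi
          have := hf.1 (l + 1 + i)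
          simp only [reflSeq, shiftSeq] at h6 ⊢
          omega
        · have := hθM j hj
          have := hf.1 (l + 1 + j)
          simp only [reflSeq, shiftSeq] at h5 ⊢
          omega
      have h4 : ∀ i < l, shiftSeq (l + 1) θ i = reflSeq M θ i := fun i hi => by
        have := hd i (by omega)
        rw [if_neg (by omega)] at this
        exact this
      have h5 : shiftSeq (l + 1) θ l = reflSeq M θ l + 1 := by
        have := hd l (by omega)
        rw [if_pos rfl] at this
        exact this
      have h' : eqUpto (l + 1) θ f := fun i hi => (h i hi).symm
      rcases h3.incr_last h4 h5 with h6 | h6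
      · exact absurd (h'.append_ltUpto h6).seqLt (seqLt_asymm h2)
      · exact fun i hi => (h'.append h6 i hi).symm
    · exact absurd (fun i hi => by rw [← h i hi]; exact hf.1 i) hθM
  · exact Or.inl h3

theorem eqUpto_refl_of_double {M L : ℕ} {θ f : ℕ → ℕ} (hθ : ∀ i, θ i ≤ M)
    (hd : DoublesAt M θ (L + L)) (hf : f ∈ boundedShift M θ) (h : eqUpto (L + L) f θ) :
    eqUpto L (reflSeq M (shiftSeq (L + L) f)) θ := by
  have h1 := (hf.2 (L + L)).2
  have h2 := (hf.2 0).1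
  rw [shiftSeq_zero] at h2
  rcases ltUpto_or_eqUpto_of_not (seqLt_asymm h1) L with h3 | h3
  · exfalso
    have h4 := h3.refl hθ
    rw [reflSeq_reflSeq (shiftSeq_le hf.1 _)] at h4
    obtain ⟨j, hj, h5, h6⟩ := h4
    have h7 : ∀ i < L, shiftSeq (L + L) θ i = reflSeq M θ i := fun i hi => by
      have := hd i (by omega)
      rw [if_neg (by omega)] at this
      exact this
    have h' : eqUpto (L + L) θ f := fun i hi => (h i hi).symm
    refine seqLt_asymm h2 (h'.append_ltUpto (l := L) ⟨j, hj, fun i hi => ?_, ?_⟩).seqLt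
    · rw [h7 i (by omega), h5 i hi]
    · rw [h7 j hj]; exact h6
  · exact h3

/-- The prefix of length `L` of `θ` or its reflection occurs in `e` at position `m`. -/
def OccursAt (M L : ℕ) (θ e : ℕ → ℕ) (m : ℕ) : Prop :=
  eqUpto L (shiftSeq m e) θ ∨ eqUpto L (reflSeq M (shiftSeq m e)) θ

theorem exists_occursAt_double {M L : ℕ} {θ e : ℕ → ℕ} (hL : 0 < L) (hd : DoublesAt M θ L)
    (he : e ∈ boundedShift M θ) {m : ℕ} (h : OccursAt M L θ e m) :
    (∃ k, shiftSeq k e ∈ range periodicSeq) ∨ ∃ k, OccursAt M (L + L) θ e k := by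
  by_cases hno : ∃ k, OccursAt M (L + L) θ e k
  · exact Or.inr hno
  left
  push Not at hno
  have hA : ∀ k, eqUpto L (shiftSeq k e) θ → eqUpto L (reflSeq M (shiftSeq (k + L) e)) θ := by
    intro k hk
    rcases eqUpto_refl_or_double hL hd (shiftSeq_mem_boundedShift he k) hk with h | h
    · rwa [shiftSeq_shiftSeq] at h
    · exact absurd (Or.inl h) (hno k)
  have hB : ∀ k, eqUpto L (reflSeq M (shiftSeq k e)) θ → eqUpto L (shiftSeq (k + L) e) θ := by
    intro k hk
    rcases eqUpto_refl_or_double hL hd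
      (reflSeq_mem_boundedShift (shiftSeq_mem_boundedShift he k)) hk with h | h
    · rw [← reflSeq_shiftSeq, shiftSeq_shiftSeq, reflSeq_reflSeq (shiftSeq_le he.1 _)] at h
      exact h
    · exact absurd (Or.inr h) (hno k)
  obtain ⟨m, hm⟩ : ∃ m, eqUpto L (shiftSeq m e) θ := by
    rcases h with h | h
    · exact ⟨m, h⟩
    · exact ⟨m + L, hB m h⟩
  have hall : ∀ j, eqUpto L (shiftSeq (m + (L + L) * j) e) θ := by
    intro j
    induction j with
    | zero => simpa using hm
    | succ j ih =>
      have := hB _ (hA _ ih)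
      rwa [show m + (L + L) * j + L + L = m + (L + L) * (j + 1) by ring] at this
  refine ⟨m, mem_range_periodicSeq (p := L + L) (by omega)
    (w := fun i => if i < L then θ i else M - θ (i - L)) fun i => ?_⟩
  have hdm := Nat.div_add_mod i (L + L)
  have hlt := Nat.mod_lt i (show L + L > 0 by omega)
  have h1 := hall (i / (L + L))
  have h2 := hA _ h1
  generalize i % (L + L) = r at *
  generalize i / (L + L) = j at *
  split_ifs with hr
  · rw [← h1 r hr, ← hdm]
    simp only [shiftSeq]; congr 1; ring
  · have h3 := h2 (r - L) (by omega)
    simp only [reflSeq, shiftSeq] at h3 ⊢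
    rw [show m + (L + L) * j + L + (r - L) = m + i by omega] at h3
    have := he.1 (m + i)
    omega

/-- Sequences that are concatenations of words of length `L` from a four-element list. -/
def blockSeqs (L : ℕ) (b : Fin 4 → ℕ → ℕ) : Set (ℕ → ℕ) :=
  {e | ∀ j, ∃ c, ∀ i < L, e (j * L + i) = b c i}

theorem mem_blockSeqs_of_occursAt {M L : ℕ} {θ e : ℕ → ℕ} (hL : 0 < L) (hθ : ∀ i, θ i ≤ M)
    (hd : DoublesAt M θ L) (hd' : DoublesAt M θ (L + L)) (he : e ∈ boundedShift M θ)
    (h : OccursAt M L θ e 0) :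
    e ∈ blockSeqs L ![θ, reflSeq M θ, shiftSeq L θ, reflSeq M (shiftSeq L θ)] := by
  have hrefl : ∀ {x : ℕ → ℕ} {k}, eqUpto L (reflSeq M (shiftSeq k e)) x →
      eqUpto L (shiftSeq k e) (reflSeq M x) := fun {x k} h i hi => by
    have := h i hi
    have := he.1 (k + i)
    simp only [reflSeq, shiftSeq] at *
    omega
  have hdbl : ∀ {f : ℕ → ℕ}, eqUpto (L + L) f θ → eqUpto L (shiftSeq L f) (shiftSeq L θ) :=
    fun h i hi => h (L + i) (by omega)
  have step : ∀ k, OccursAt M L θ e k → OccursAt M L θ e (k + L) ∨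
      ((eqUpto L (shiftSeq (k + L) e) (shiftSeq L θ) ∨
        eqUpto L (reflSeq M (shiftSeq (k + L) e)) (shiftSeq L θ)) ∧
        OccursAt M L θ e (k + L + L)) := by
    rintro k (hk | hk)
    · have hmem := shiftSeq_mem_boundedShift he k
      rcases eqUpto_refl_or_double hL hd hmem hk with h | h
      · rw [shiftSeq_shiftSeq] at h
        exact Or.inl (Or.inr h)
      · have h3 := eqUpto_refl_of_double hθ hd' hmem h
        have h4 := hdbl h
        rw [shiftSeq_shiftSeq] at h3 h4
        rw [← add_assoc] at h3
        exact Or.inr ⟨Or.inl h4, Or.inr h3⟩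
    · have hmem := reflSeq_mem_boundedShift (shiftSeq_mem_boundedShift he k)
      rcases eqUpto_refl_or_double hL hd hmem hk with h | h
      · rw [← reflSeq_shiftSeq, shiftSeq_shiftSeq, reflSeq_reflSeq (shiftSeq_le he.1 _)] at h
        exact Or.inl (Or.inl h)
      · have h3 := eqUpto_refl_of_double hθ hd' hmem h
        have h4 := hdbl h
        rw [← reflSeq_shiftSeq, shiftSeq_shiftSeq, reflSeq_reflSeq (shiftSeq_le he.1 _),
          ← add_assoc] at h3
        rw [← reflSeq_shiftSeq, shiftSeq_shiftSeq] at h4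
        exact Or.inr ⟨Or.inr h4, Or.inl h3⟩
  have main : ∀ j, OccursAt M L θ e (j * L) ∨
      ((eqUpto L (shiftSeq (j * L) e) (shiftSeq L θ) ∨
        eqUpto L (reflSeq M (shiftSeq (j * L) e)) (shiftSeq L θ)) ∧
        OccursAt M L θ e (j * L + L)) := by
    intro j
    induction j with
    | zero => left; simpa using h
    | succ j ih =>
      rw [Nat.succ_mul]
      rcases ih with ih | ih
      · exact step _ ih
      · exact Or.inl ih.2
  intro j
  rcases main j with (h | h) | ⟨h | h, -⟩
  · exact ⟨0, h⟩
  · exact ⟨1, hrefl h⟩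
  · exact ⟨2, h⟩
  · exact ⟨3, hrefl h⟩

/-- Tails of elements of `U'_b ∖ U'_a` are periodic or concatenations of few long words. -/
theorem exists_blocks_of_free {M : ℕ} (hM : 0 < M) {a b : ℝ} (hab : a < b) (hbM : b ≤ M + 1)
    (ha : a ∈ closure (UnivBases M)) (hU : ∀ q, a < q → q < b → q ∉ UnivBases M) (K : ℕ) :
    ∃ L ≥ K, 0 < L ∧ ∃ B : Fin 4 → ℕ → ℕ, ∀ d ∈ UnivSeqs M b \ UnivSeqs M a, ∃ N,
      shiftSeq N d ∈ blockSeqs L B ∪ range periodicSeq := by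
  have ha1 := one_lt_of_mem_closure hM ha
  obtain ⟨n, θ, hθ, h1, h2, hper, hbθ⟩ := exists_tmSeq_of_free hM hab hbM ha hU
  have hlen := hθ.lt_len
  have hrefl := not_quasi_lt_reflSeq hM hab ha hU 0
  rw [shiftSeq_zero] at hrefl
  have hLpos : ∀ k, 0 < (n + 1) * 2 ^ k := fun k => by positivity
  have h2L : ∀ k, (n + 1) * 2 ^ (k + 1) = (n + 1) * 2 ^ k + (n + 1) * 2 ^ k := fun k => by
    rw [pow_succ]; ring
  refine ⟨(n + 1) * 2 ^ K, (hlen K).le, hLpos K,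
    ![θ, reflSeq M θ, shiftSeq ((n + 1) * 2 ^ K) θ, reflSeq M (shiftSeq ((n + 1) * 2 ^ K) θ)],
    fun d hd => ?_⟩
  have hblocks : ∀ e ∈ boundedShift M θ, ¬ seqLt e (quasi a) → (∃ N, shiftSeq N e ∈
      range periodicSeq) ∨ ∃ N, OccursAt M ((n + 1) * 2 ^ K) θ e N := by
    intro e he hge
    have hocc : ∀ k, (∃ N, shiftSeq N e ∈ range periodicSeq) ∨
        ∃ N, OccursAt M ((n + 1) * 2 ^ k) θ e N := by
      intro k
      induction k with
      | zero =>
        rcases eq_or_exists_eqUpto h1 h2 hper he hge with rfl | ⟨m, hm⟩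
        · left
          refine ⟨0, mem_range_periodicSeq (p := n + 1) n.succ_pos (w := quasi a) fun i => ?_⟩
          rw [shiftSeq_zero]
          have hp : Function.Periodic (quasi a) (n + 1) := fun i => by
            have := congrFun hper i
            rwa [shiftSeq, add_comm] at this
          exact (hp.map_mod_nat i).symm
        · exact Or.inr ⟨m, Or.inl (by simpa using hm)⟩
      | succ k ih =>
        rcases ih with ih | ⟨m, hm⟩
        · exact Or.inl ih
        · rw [h2L]
          exact exists_occursAt_double (hLpos k) (hθ.doubles k) he hm
    exact hocc K
  have hfin : ∀ e ∈ boundedShift M θ, ∀ N, OccursAt M ((n + 1) * 2 ^ K) θ e N →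
      shiftSeq N e ∈ blockSeqs ((n + 1) * 2 ^ K) ![θ, reflSeq M θ,
        shiftSeq ((n + 1) * 2 ^ K) θ, reflSeq M (shiftSeq ((n + 1) * 2 ^ K) θ)] := fun e he N hN =>
    mem_blockSeqs_of_occursAt (hLpos K) hθ.le (hθ.doubles K) (by rw [← h2L]; exact hθ.doubles _)
      (shiftSeq_mem_boundedShift he N) (by rwa [OccursAt, shiftSeq_zero])
  have hper_refl : ∀ e ∈ range periodicSeq, reflSeq M e ∈ range periodicSeq := by
    rintro _ ⟨w, rfl⟩
    rcases Nat.eq_zero_or_pos w.length with hw | hw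
    · obtain rfl := List.length_eq_zero_iff.1 hw
      exact mem_range_periodicSeq (p := 1) one_pos (w := fun _ => M) fun i => by
        simp [reflSeq, periodicSeq]
    · exact mem_range_periodicSeq hw (w := fun i => M - w.getD i 0) fun i => rfl
  obtain ⟨N, e, hNe, he, hge⟩ := exists_tail_mem_boundedShift ha1 hab hbM hθ.le
    (seqLt_asymm (hθ.shift_lt 1 one_pos)) hrefl ⟨n, fun i hi => (h1 i hi).symm, by omega⟩ hbθ hd
  rcases hNe with rfl | rfl
  · rcases hblocks _ he hge with ⟨m, hm⟩ | ⟨m, hm⟩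
    · rw [shiftSeq_shiftSeq] at hm
      exact ⟨_, Or.inr hm⟩
    · have := hfin _ he m hm
      rw [shiftSeq_shiftSeq] at this
      exact ⟨_, Or.inl this⟩
  · have hdM := hd.1.1
    rcases hblocks _ he hge with ⟨m, hm⟩ | ⟨m, hm⟩
    · have := hper_refl _ hm
      rw [← reflSeq_shiftSeq, reflSeq_reflSeq (shiftSeq_le (shiftSeq_le hdM N) m),
        shiftSeq_shiftSeq] at this
      exact ⟨_, Or.inr this⟩
    · have he' := reflSeq_mem_boundedShift he
      rw [reflSeq_reflSeq (shiftSeq_le hdM N)] at he'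
      have hm' : OccursAt M ((n + 1) * 2 ^ K) θ (shiftSeq N d) m := by
        rcases hm with hm | hm
        · exact Or.inr hm
        · rw [← reflSeq_shiftSeq, reflSeq_reflSeq (shiftSeq_le (shiftSeq_le hdM N) m)] at hm
          exact Or.inl hm
      have := hfin _ he' m hm'
      rw [shiftSeq_shiftSeq] at this
      exact ⟨_, Or.inl this⟩

theorem abs_piQ_sub_le {M : ℕ} {q : ℝ} (hq : 1 < q) {d e : ℕ → ℕ} (hd : ∀ i, d i ≤ M)
    (he : ∀ i, e i ≤ M) {n : ℕ} (h : ∀ i < n, d i = e i) :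
    |piQ q d - piQ q e| ≤ M / (q - 1) / q ^ n := by
  have hqn : 0 < q ^ n := by have : 0 < q := by linarith
                             positivity
  have hs : ∑ i ∈ Finset.range n, (d i : ℝ) / q ^ (i + 1) =
      ∑ i ∈ Finset.range n, (e i : ℝ) / q ^ (i + 1) :=
    Finset.sum_congr rfl fun i hi => by rw [h i (Finset.mem_range.1 hi)]
  rw [piQ_split hq hd n, piQ_split hq he n, hs, add_sub_add_left_eq_sub, ← sub_div, abs_div,
    abs_of_pos hqn]
  have h1 := piQ_nonneg hq (shiftSeq n d)
  have h2 := piQ_nonneg hq (shiftSeq n e)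
  have h3 := piQ_le hq (shiftSeq_le hd n)
  have h4 := piQ_le hq (shiftSeq_le he n)
  gcongr
  exact abs_sub_le_iff.2 ⟨by linarith, by linarith⟩

theorem dimH_piQ_image_blockSeqs_le {M : ℕ} (hM : 0 < M) {L : ℕ} (hL : 0 < L)
    (B : Fin 4 → ℕ → ℕ) :
    dimH (piQ ((M : ℝ) + 1) '' {e | (∀ i, e i ≤ M) ∧ e ∈ blockSeqs L B}) ≤
      ((2 / L : NNReal) : ENNReal) := by
  have hM1 : (1 : ℝ) ≤ M := by exact_mod_cast hM
  have hq : 1 < (M : ℝ) + 1 := by linarith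
  have hL' : (L : ℝ) ≠ 0 := by positivity
  let t : ∀ j : ℕ, (Fin j → Fin 4) → Set ℝ := fun j c => piQ ((M : ℝ) + 1) ''
    {e | (∀ i, e i ≤ M) ∧ ∀ k : Fin j, ∀ i < L, e (k * L + i) = B (c k) i}
  have ht : ∀ j c, Metric.ediam (t j c) ≤ (2⁻¹ : ENNReal) ^ (j * L) := by
    intro j c
    refine Metric.ediam_le ?_
    rintro _ ⟨d, ⟨hd, hdB⟩, rfl⟩ _ ⟨e, ⟨he, heB⟩, rfl⟩
    have hde : ∀ i < j * L, d i = e i := by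
      intro i hi
      have hk : i / L < j := (Nat.div_lt_iff_lt_mul hL).2 hi
      have h1 := hdB ⟨i / L, hk⟩ (i % L) (Nat.mod_lt _ hL)
      have h2 := heB ⟨i / L, hk⟩ (i % L) (Nat.mod_lt _ hL)
      rw [Nat.div_add_mod'] at h1 h2
      rw [h1, h2]
    have h := abs_piQ_sub_le hq hd he hde
    rw [add_sub_cancel_right, div_self (by positivity)] at h
    have h2 : |piQ ((M : ℝ) + 1) d - piQ ((M : ℝ) + 1) e| ≤ (2⁻¹ : ℝ) ^ (j * L) := by
      refine h.trans ?_
      rw [one_div, ← inv_pow]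
      gcongr
      linarith
    rw [edist_dist, Real.dist_eq]
    refine (ENNReal.ofReal_le_ofReal h2).trans_eq ?_
    rw [ENNReal.ofReal_pow (by norm_num), ENNReal.ofReal_inv_of_pos two_pos]
    simp
  refine dimH_le_of_hausdorffMeasure_ne_top (ne_top_of_le_ne_top ENNReal.one_ne_top
    ((Measure.hausdorffMeasure_le_liminf_sum (l := atTop) _ _ (fun j => (2⁻¹ : ENNReal) ^ (j * L))
      ?_ t (Eventually.of_forall ht) (Eventually.of_forall fun j => ?_)).trans ?_))
  · exact (ENNReal.tendsto_pow_atTop_nhds_zero_of_lt_one (by simp)).comp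
      (tendsto_id.atTop_mul_const' hL)
  · rintro _ ⟨e, ⟨he, heB⟩, rfl⟩
    choose c hc using heB
    exact mem_iUnion.2 ⟨fun k => c k, e, ⟨he, fun k => hc k⟩, rfl⟩
  · refine liminf_le_of_le (by isBoundedDefault) fun b hb => ?_
    obtain ⟨j, hj⟩ := hb.exists
    refine hj.trans ?_
    calc ∑ c, Metric.ediam (t j c) ^ (((2 / L : NNReal) : ℝ))
        ≤ ∑ c : Fin j → Fin 4, ((2⁻¹ : ENNReal) ^ (j * L)) ^ (((2 / L : NNReal) : ℝ)) :=
          Finset.sum_le_sum fun c _ => ENNReal.rpow_le_rpow (ht j c) (NNReal.coe_nonneg _)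
      _ = 4 ^ j * (2⁻¹ ^ 2) ^ j := by
          rw [← ENNReal.rpow_natCast, ← ENNReal.rpow_mul, ← pow_mul,
            ← ENNReal.rpow_natCast _ (2 * j), Finset.sum_const, nsmul_eq_mul]
          congr 2
          · simp
          · push_cast
            field_simp
      _ = 1 := by
          rw [← mul_pow, ← ENNReal.inv_pow, show (4 : ENNReal) = 2 ^ 2 by norm_num,
            ENNReal.mul_inv_cancel (by simp) (by simp), one_pow]
      _ ≤ 1 := le_rfl

theorem dimH_piQ_image_tails_le {M : ℕ} {q : ℝ} (hq : 1 < q) (S : Set (ℕ → ℕ)) :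
    dimH (piQ q '' {d | (∀ i, d i ≤ M) ∧ ∃ N, shiftSeq N d ∈ S}) ≤
      dimH (piQ q '' {e | (∀ i, e i ≤ M) ∧ e ∈ S}) := by
  have hsub : piQ q '' {d | (∀ i, d i ≤ M) ∧ ∃ N, shiftSeq N d ∈ S} ⊆
      ⋃ N : ℕ, ⋃ w : Fin N → ℕ, (fun x => ∑ i : Fin N, (w i : ℝ) / q ^ ((i : ℕ) + 1) +
        (q ^ N)⁻¹ * x) '' (piQ q '' {e | (∀ i, e i ≤ M) ∧ e ∈ S}) := by
    rintro _ ⟨d, ⟨hd, N, hN⟩, rfl⟩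
    refine mem_iUnion₂.2 ⟨N, fun i => d i, _, ⟨_, ⟨shiftSeq_le hd N, hN⟩, rfl⟩, ?_⟩
    simp only [piQ_split hq hd N, Finset.sum_range, inv_mul_eq_div]
  refine (dimH_mono hsub).trans ?_
  simp only [dimH_iUnion]
  refine iSup₂_le fun N w => ?_
  refine LipschitzWith.dimH_image_le (K := ‖(q ^ N)⁻¹‖₊) (LipschitzWith.of_dist_le_mul
    fun x y => ?_) _
  rw [dist_add_left, dist_eq_norm, dist_eq_norm, ← mul_sub, norm_mul, coe_nnnorm]

/-- For a connected component `(q₀, q₀^*)` of `(q', M+1) \ closure U`, the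
Hausdorff dimension of `π_{M+1}(U'_{q₀^*} \ U'_{q₀})` equals `0`. -/
theorem stmt14 (M : ℕ) (hM : 0 < M) (q₀ q₀star : ℝ) (hcc : CC M q₀ q₀star) :
    dimH (piQ ((M : ℝ) + 1) '' (UnivSeqs M q₀star \ UnivSeqs M q₀)) = 0 := by
  obtain ⟨ha, hb, hU⟩ := left_mem_closure_of_CC hM hcc
  have hq : 1 < (M : ℝ) + 1 := by simpa using hM
  refine nonpos_iff_eq_zero.1 (ge_of_tendsto' (x := atTop)
    (f := fun K : ℕ => (2 : ENNReal) / K) ?_ fun K => ?_)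
  · simpa using ENNReal.Tendsto.const_div ENNReal.tendsto_nat_nhds_top (Or.inr ENNReal.ofNat_ne_top)
  obtain ⟨L, hKL, hL, B, h⟩ := exists_blocks_of_free hM hcc.1 hb ha hU K
  have hsub : UnivSeqs M q₀star \ UnivSeqs M q₀ ⊆
      {d | (∀ i, d i ≤ M) ∧ ∃ N, shiftSeq N d ∈ blockSeqs L B ∪ range periodicSeq} :=
    fun d hd => ⟨hd.1.1, h d hd⟩
  refine (dimH_mono (image_mono hsub)).trans ((dimH_piQ_image_tails_le hq _).trans ?_)
  have hun : {e : ℕ → ℕ | (∀ i, e i ≤ M) ∧ e ∈ blockSeqs L B ∪ range periodicSeq} ⊆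
      {e | (∀ i, e i ≤ M) ∧ e ∈ blockSeqs L B} ∪ range periodicSeq := by
    rintro e ⟨he, h | h⟩
    exacts [Or.inl ⟨he, h⟩, Or.inr h]
  refine (dimH_mono (image_mono hun)).trans ?_
  rw [image_union, dimH_union, ((countable_range periodicSeq).image _).dimH_zero, max_zero]
  refine (dimH_piQ_image_blockSeqs_le hM hL B).trans ?_
  rw [ENNReal.coe_div (by positivity)]
  push_cast
  gcongr

end
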